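/- arXiv:2410.22019 — 5 statements merged into one kernel-verified Lean document; each statement's English description precedes it below -/
import Mathlib

section
/- For each fixed integer k ≥ 5 there is a constant C > 0 such that for all sufficiently large N, g(k,N) ≤ C · log_{(k−3)} N, where log_{(i)} denotes the base-2 logarithm iterated i times. -/
/-- The Erdős–Rogers function `g(k,N) = f^{(k)}_{k+1,k+2}(N)`: the minimum, over all
`k`-uniform hypergraphs `E` on vertex set `{0,…,N-1}` containing no `k+2` vertices all of whose
`k`-subsets are edges, of the maximum size of a vertex subset containing no `k+1` vertices all
of whose `k`-subsets are edges. -/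
noncomputable def erdosRogersG (k N : ℕ) : ℕ :=
  sInf {m : ℕ | ∃ E : Finset ℕ → Prop,
    (¬ ∃ S ⊆ Finset.range N, S.card = k + 2 ∧ ∀ e ⊆ S, e.card = k → E e) ∧
    m = sSup {c : ℕ | ∃ W ⊆ Finset.range N, W.card = c ∧
      ¬ ∃ S ⊆ W, S.card = k + 1 ∧ ∀ e ⊆ S, e.card = k → E e}}

/-- The base-2 logarithm iterated `i` times. -/
noncomputable def iterLog (i : ℕ) (x : ℝ) : ℝ := (Real.logb 2)^[i] x

/-- The largest binary digit in which `u` and `v` differ. -/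
noncomputable def topDiff (u v : ℕ) : ℕ := sInf {d | u / 2 ^ (d + 1) = v / 2 ^ (d + 1)}

lemma topDiff_comm (u v : ℕ) : topDiff u v = topDiff v u := by
  unfold topDiff
  congr 1
  ext d
  exact eq_comm

lemma div_two_pow_eq_of_le {u v d e : ℕ} (h : d ≤ e) (huv : u / 2 ^ d = v / 2 ^ d) :
    u / 2 ^ e = v / 2 ^ e := by
  obtain ⟨t, rfl⟩ := Nat.exists_eq_add_of_le h
  rw [pow_add, ← Nat.div_div_eq_div_mul, ← Nat.div_div_eq_div_mul, huv]

lemma topDiff_le_iff {u v d : ℕ} : topDiff u v ≤ d ↔ u / 2 ^ (d + 1) = v / 2 ^ (d + 1) := by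
  constructor
  · intro h
    have hne : {d | u / 2 ^ (d + 1) = v / 2 ^ (d + 1)}.Nonempty := by
      refine ⟨u + v, ?_⟩
      have h1 : u + v < 2 ^ (u + v + 1) :=
        (Nat.lt_two_pow_self).trans (Nat.pow_lt_pow_right (by norm_num) (by omega))
      simp only [Set.mem_ofPred_eq]
      rw [Nat.div_eq_of_lt (by omega), Nat.div_eq_of_lt (by omega)]
    exact div_two_pow_eq_of_le (Nat.succ_le_succ h) (Nat.sInf_mem hne)
  · intro h
    exact Nat.sInf_le h

lemma topDiff_lt {u v M : ℕ} (hne : u ≠ v) (hu : u < 2 ^ M) (hv : v < 2 ^ M) :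
    topDiff u v < M := by
  rcases M with _ | M
  · simp only [pow_zero, Nat.lt_one_iff] at hu hv
    omega
  · rw [Nat.lt_succ_iff, topDiff_le_iff, Nat.div_eq_of_lt hu, Nat.div_eq_of_lt hv]

lemma div_ne_of_le_topDiff {u v d : ℕ} (hne : u ≠ v) (h : d ≤ topDiff u v) :
    u / 2 ^ d ≠ v / 2 ^ d := by
  rcases d with _ | d
  · simpa using hne
  · intro h'
    have := topDiff_le_iff.2 h'
    omega

lemma topDiff_trans_of_lt {u v w : ℕ} (huv : u < v) (hvw : v < w) :
    topDiff u w = max (topDiff u v) (topDiff v w) := by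
  apply eq_of_forall_ge_iff
  intro d
  rw [max_le_iff, topDiff_le_iff, topDiff_le_iff, topDiff_le_iff]
  have h1 : u / 2 ^ (d + 1) ≤ v / 2 ^ (d + 1) := Nat.div_le_div_right huv.le
  have h2 : v / 2 ^ (d + 1) ≤ w / 2 ^ (d + 1) := Nat.div_le_div_right hvw.le
  omega

lemma topDiff_ne_of_lt {u v w : ℕ} (huv : u < v) (hvw : v < w) :
    topDiff u v ≠ topDiff v w := by
  intro h
  have h1 := div_ne_of_le_topDiff huv.ne le_rfl
  have h2 := div_ne_of_le_topDiff hvw.ne h.le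
  have h3 := topDiff_le_iff.1 (le_refl (topDiff u v))
  have h4 := topDiff_le_iff.1 h.ge
  have h5 : u / 2 ^ topDiff u v ≤ v / 2 ^ topDiff u v := Nat.div_le_div_right huv.le
  have h6 : v / 2 ^ topDiff u v ≤ w / 2 ^ topDiff u v := Nat.div_le_div_right hvw.le
  rw [pow_succ, ← Nat.div_div_eq_div_mul, ← Nat.div_div_eq_div_mul] at h3 h4
  omega

/-- Every triple spans a strictly isosceles triangle. -/
lemma topDiff_isosceles {u v w : ℕ} (huv : u ≠ v) (huw : u ≠ w) (hvw : v ≠ w) :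
    (topDiff u v < topDiff u w ∧ topDiff u w = topDiff v w) ∨
    (topDiff u w < topDiff u v ∧ topDiff u v = topDiff v w) ∨
    (topDiff v w < topDiff u v ∧ topDiff u v = topDiff u w) := by
  have key : ∀ {a b c : ℕ}, a < b → b < c →
      topDiff a c = max (topDiff a b) (topDiff b c) ∧ topDiff a b ≠ topDiff b c :=
    fun h h' => ⟨topDiff_trans_of_lt h h', topDiff_ne_of_lt h h'⟩
  have e1 := topDiff_comm u v
  have e2 := topDiff_comm u w
  have e3 := topDiff_comm v w
  rcases lt_or_gt_of_ne huv with h1 | h1 <;> rcases lt_or_gt_of_ne huw with h2 | h2 <;>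
    rcases lt_or_gt_of_ne hvw with h3 | h3
  · have := key h1 h3; omega
  · have := key h2 h3; omega
  · omega
  · have := key h2 h1; omega
  · have := key h1 h2; omega
  · omega
  · have := key h3 h2; omega
  · have := key h3 h1; omega

/-- All values of `topDiff` on pairs of distinct elements of `S`. -/
noncomputable def diffSet (S : Finset ℕ) : Finset ℕ := S.offDiag.image fun x => topDiff x.1 x.2

lemma mem_diffSet {S : Finset ℕ} {d : ℕ} :
    d ∈ diffSet S ↔ ∃ u ∈ S, ∃ v ∈ S, u ≠ v ∧ topDiff u v = d := by
  simp only [diffSet, Finset.mem_image, Finset.mem_offDiag, Prod.exists]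
  constructor
  · rintro ⟨u, v, ⟨hu, hv, hne⟩, h⟩
    exact ⟨u, hu, v, hv, hne, h⟩
  · rintro ⟨u, hu, v, hv, hne, h⟩
    exact ⟨u, v, ⟨hu, hv, hne⟩, h⟩

lemma diffSet_mono {S T : Finset ℕ} (h : S ⊆ T) : diffSet S ⊆ diffSet T := by
  intro d
  rw [mem_diffSet, mem_diffSet]
  rintro ⟨u, hu, v, hv, hne, hd⟩
  exact ⟨u, h hu, v, h hv, hne, hd⟩

lemma diffSet_subset_range {S : Finset ℕ} {M : ℕ} (h : S ⊆ Finset.range (2 ^ M)) :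
    diffSet S ⊆ Finset.range M := by
  intro d
  rw [mem_diffSet]
  rintro ⟨u, hu, v, hv, hne, rfl⟩
  exact Finset.mem_range.2
    (topDiff_lt hne (Finset.mem_range.1 (h hu)) (Finset.mem_range.1 (h hv)))

/-- The elements of `S` other than `p` branch off from `p` at pairwise distinct digits. -/
def IsPivot (S : Finset ℕ) (p : ℕ) : Prop :=
  p ∈ S ∧ Set.InjOn (fun u => topDiff u p) (S.erase p : Finset ℕ)

/-- The binary tree spanned by `S` is a caterpillar. -/
def IsComb (S : Finset ℕ) : Prop := ∃ p, IsPivot S p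

lemma IsPivot.diffSet_eq {S : Finset ℕ} {p : ℕ} (h : IsPivot S p) :
    diffSet S = (S.erase p).image fun u => topDiff u p := by
  ext d
  rw [mem_diffSet, Finset.mem_image]
  constructor
  · rintro ⟨u, hu, v, hv, hne, rfl⟩
    by_cases hup : u = p
    · subst hup
      exact ⟨v, Finset.mem_erase.2 ⟨hne.symm, hv⟩, topDiff_comm _ _⟩
    by_cases hvp : v = p
    · subst hvp
      exact ⟨u, Finset.mem_erase.2 ⟨hne, hu⟩, rfl⟩
    have hu' : u ∈ S.erase p := Finset.mem_erase.2 ⟨hup, hu⟩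
    have hv' : v ∈ S.erase p := Finset.mem_erase.2 ⟨hvp, hv⟩
    have hd : topDiff u p ≠ topDiff v p := fun hh =>
      hne (h.2 (Finset.mem_coe.2 hu') (Finset.mem_coe.2 hv') hh)
    rcases topDiff_isosceles hne hup hvp with ⟨_, h2⟩ | ⟨_, h2⟩ | ⟨_, h2⟩
    · exact absurd h2 hd
    · exact ⟨v, hv', h2.symm⟩
    · exact ⟨u, hu', h2.symm⟩
  · rintro ⟨u, hu, rfl⟩
    obtain ⟨h1, h2⟩ := Finset.mem_erase.1 hu
    exact ⟨u, h2, p, h.1, h1, rfl⟩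

lemma IsComb.card_diffSet {S : Finset ℕ} (h : IsComb S) : (diffSet S).card + 1 = S.card := by
  obtain ⟨p, hp⟩ := h
  rw [hp.diffSet_eq, Finset.card_image_of_injOn hp.2, Finset.card_erase_add_one hp.1]

lemma IsPivot.mono {S T : Finset ℕ} {p : ℕ} (h : IsPivot T p) (hST : S ⊆ T) (hp : p ∈ S) :
    IsPivot S p :=
  ⟨hp, h.2.mono (Finset.coe_subset.2 (Finset.erase_subset_erase p hST))⟩

lemma IsComb.subset {S T : Finset ℕ} (hT : IsComb T) (hST : S ⊆ T) (hS : S.Nonempty) :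
    IsComb S := by
  obtain ⟨p, hp⟩ := hT
  by_cases hpS : p ∈ S
  · exact ⟨p, hp.mono hST hpS⟩
  have hinj : ∀ u ∈ S, ∀ v ∈ S, topDiff u p = topDiff v p → u = v := by
    intro u hu v hv
    have hup : u ≠ p := fun h => hpS (h ▸ hu)
    have hvp : v ≠ p := fun h => hpS (h ▸ hv)
    exact fun h => hp.2 (by simp [hup, hST hu]) (by simp [hvp, hST hv]) h
  obtain ⟨q, hq, hmin⟩ := S.exists_min_image (fun u => topDiff u p) hS
  have key : ∀ u ∈ S, u ≠ q → topDiff u q = topDiff u p := by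
    intro u hu huq
    have hup : u ≠ p := fun h => hpS (h ▸ hu)
    have hqp : q ≠ p := fun h => hpS (h ▸ hq)
    have h1 := hmin u hu
    have h2 : topDiff u p ≠ topDiff q p := fun h => huq (hinj u hu q hq h)
    have h3 := topDiff_isosceles huq hup hqp
    omega
  refine ⟨q, hq, fun u hu v hv huv => ?_⟩
  simp only [Finset.coe_erase, Set.mem_sdiff, Finset.mem_coe, Set.mem_singleton_iff] at hu hv
  simp only [key u hu.1 hu.2, key v hv.1 hv.2] at huv
  exact hinj u hu.1 v hv.1 huv

lemma IsPivot.exists_subset {T e : Finset ℕ} {p : ℕ} (h : IsPivot T p) (he : e ⊆ diffSet T) :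
    ∃ S ⊆ T, p ∈ S ∧ IsPivot S p ∧ diffSet S = e := by
  classical
  have hsub : insert p ((T.erase p).filter fun u => topDiff u p ∈ e) ⊆ T := by
    intro u hu
    rcases Finset.mem_insert.1 hu with rfl | hu
    · exact h.1
    · exact Finset.mem_of_mem_erase (Finset.mem_filter.1 hu).1
  have hpiv := h.mono hsub (Finset.mem_insert_self _ _)
  refine ⟨_, hsub, Finset.mem_insert_self _ _, hpiv, ?_⟩
  rw [hpiv.diffSet_eq, Finset.erase_insert (by simp)]
  ext d
  simp only [Finset.mem_image, Finset.mem_filter]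
  constructor
  · rintro ⟨u, ⟨_, hu⟩, rfl⟩
    exact hu
  · intro hd
    have := he hd
    rw [h.diffSet_eq, Finset.mem_image] at this
    obtain ⟨u, hu, rfl⟩ := this
    exact ⟨u, ⟨hu, hd⟩, rfl⟩

lemma IsComb.exists_subset {T e : Finset ℕ} (h : IsComb T) (he : e ⊆ diffSet T) :
    ∃ S ⊆ T, IsComb S ∧ diffSet S = e ∧ S.card = e.card + 1 := by
  obtain ⟨p, hp⟩ := h
  obtain ⟨S, hS, _, h1, h2⟩ := hp.exists_subset he
  exact ⟨S, hS, ⟨p, h1⟩, h2, by rw [← h2, IsComb.card_diffSet ⟨p, h1⟩]⟩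

lemma isComb_singleton (a : ℕ) : IsComb {a} := ⟨a, by simp, by simp⟩

/-- Adding an element which branches off from a comb above its root gives a comb. -/
lemma IsComb.insert_of_const {B : Finset ℕ} {v r : ℕ} (hB : IsComb B) (hv : v ∉ B)
    (h : ∀ u ∈ B, topDiff u v = r) : IsComb (insert v B) := by
  obtain ⟨p, hp⟩ := hB
  have hpv : p ≠ v := fun hh => hv (hh ▸ hp.1)
  have hlt : ∀ u ∈ B, u ≠ p → topDiff u p < r := by
    intro u hu hup
    have huv : u ≠ v := fun hh => hv (hh ▸ hu)
    have h1 := h u hu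
    have h2 := h p hp.1
    rcases topDiff_isosceles hup huv hpv with h3 | h3 | h3 <;> omega
  have h2 : topDiff v p = r := by rw [topDiff_comm]; exact h p hp.1
  refine ⟨p, Finset.mem_insert_of_mem hp.1, ?_⟩
  intro a ha b hb hab
  simp only [Finset.coe_erase, Finset.coe_insert, Set.mem_sdiff, Set.mem_insert_iff,
    Finset.mem_coe, Set.mem_singleton_iff] at ha hb
  simp only at hab
  obtain ⟨ha1, ha2⟩ := ha
  obtain ⟨hb1, hb2⟩ := hb
  rcases ha1 with rfl | ha1 <;> rcases hb1 with rfl | hb1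
  · rfl
  · have := hlt b hb1 hb2; omega
  · have := hlt a ha1 ha2; omega
  · exact hp.2 (by simp [ha1, ha2]) (by simp [hb1, hb2]) hab

lemma diffSet_insert_of_const {B : Finset ℕ} {v r : ℕ} (hB : B.Nonempty) (hv : v ∉ B)
    (h : ∀ u ∈ B, topDiff u v = r) : diffSet (insert v B) = insert r (diffSet B) := by
  ext d
  rw [Finset.mem_insert, mem_diffSet, mem_diffSet]
  constructor
  · rintro ⟨a, ha, b, hb, hab, rfl⟩
    rcases Finset.mem_insert.1 ha with rfl | ha' <;> rcases Finset.mem_insert.1 hb with rfl | hb'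
    · exact absurd rfl hab
    · left; rw [topDiff_comm]; exact h b hb'
    · left; exact h a ha'
    · right; exact ⟨a, ha', b, hb', hab, rfl⟩
  · rintro (rfl | ⟨a, ha, b, hb, hab, rfl⟩)
    · obtain ⟨b, hb⟩ := hB
      exact ⟨b, Finset.mem_insert_of_mem hb, v, Finset.mem_insert_self _ _,
        fun hh => hv (hh ▸ hb), h b hb⟩
    · exact ⟨a, Finset.mem_insert_of_mem ha, b, Finset.mem_insert_of_mem hb, hab, rfl⟩

lemma notMem_diffSet_of_const {B : Finset ℕ} {v r : ℕ} (hv : v ∉ B)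
    (h : ∀ u ∈ B, topDiff u v = r) : r ∉ diffSet B := by
  rw [mem_diffSet]
  rintro ⟨a, ha, b, hb, hab, hd⟩
  have h1 := h a ha
  have h2 := h b hb
  have hav : a ≠ v := fun hh => hv (hh ▸ ha)
  have hbv : b ≠ v := fun hh => hv (hh ▸ hb)
  rcases topDiff_isosceles hab hav hbv with h3 | h3 | h3 <;> omega

/-- `A` and `B` hang to the left and to the right of a common node of level `r`. -/
structure IsSplit (A B : Finset ℕ) (r : ℕ) : Prop where
  left_nonempty : A.Nonempty
  right_nonempty : B.Nonempty
  lt : ∀ a ∈ A, ∀ b ∈ B, a < b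
  eq : ∀ a ∈ A, ∀ b ∈ B, topDiff a b = r

namespace IsSplit

variable {A B A' B' : Finset ℕ} {r r' : ℕ}

lemma disjoint (h : IsSplit A B r) : Disjoint A B :=
  Finset.disjoint_left.2 fun a ha hb => lt_irrefl _ (h.lt a ha a hb)

lemma card_union (h : IsSplit A B r) : (A ∪ B).card = A.card + B.card :=
  Finset.card_union_of_disjoint h.disjoint

lemma mono (h : IsSplit A B r) (hA : A' ⊆ A) (hB : B' ⊆ B) (hA' : A'.Nonempty)
    (hB' : B'.Nonempty) : IsSplit A' B' r :=
  ⟨hA', hB', fun a ha b hb => h.lt a (hA ha) b (hB hb),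
    fun a ha b hb => h.eq a (hA ha) b (hB hb)⟩

lemma const_left (h : IsSplit A B r) {b : ℕ} (hb : b ∈ B) :
    b ∉ A ∧ ∀ u ∈ A, topDiff u b = r :=
  ⟨fun hA => lt_irrefl _ (h.lt b hA b hb), fun u hu => h.eq u hu b hb⟩

lemma const_right (h : IsSplit A B r) {a : ℕ} (ha : a ∈ A) :
    a ∉ B ∧ ∀ u ∈ B, topDiff u a = r :=
  ⟨fun hB => lt_irrefl _ (h.lt a ha a hB), fun u hu => by rw [topDiff_comm]; exact h.eq a ha u hu⟩

lemma level_eq (h : IsSplit A B r) (h' : IsSplit A' B' r') (hu : A ∪ B = A' ∪ B') :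
    r = r' ∧ A ⊆ A' := by
  have hne : (A ∪ B).Nonempty := h.left_nonempty.mono Finset.subset_union_left
  obtain ⟨m, hm, hmin⟩ := (A ∪ B).exists_minimal hne
  obtain ⟨x, hx, hmax⟩ := (A ∪ B).exists_maximal hne
  have split_mem : ∀ {C D : Finset ℕ} {s : ℕ}, IsSplit C D s → A ∪ B = C ∪ D → m ∈ C ∧ x ∈ D := by
    intro C D s hs hCD
    rw [hCD] at hm hx
    constructor
    · rcases Finset.mem_union.1 hm with hm | hm
      · exact hm
      · obtain ⟨c, hc⟩ := hs.left_nonempty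
        have h1 := hs.lt c hc m hm
        have h2 := hmin (y := c) (by rw [hCD]; exact Finset.mem_union_left _ hc) h1.le
        omega
    · rcases Finset.mem_union.1 hx with hx | hx
      · obtain ⟨c, hc⟩ := hs.right_nonempty
        have h1 := hs.lt x hx c hc
        have h2 := hmax (y := c) (by rw [hCD]; exact Finset.mem_union_right _ hc) h1.le
        omega
      · exact hx
  obtain ⟨hmA, hxB⟩ := split_mem h rfl
  obtain ⟨hmA', hxB'⟩ := split_mem h' hu
  have hr : r = r' := by rw [← h.eq m hmA x hxB, h'.eq m hmA' x hxB']
  refine ⟨hr, fun v hv => ?_⟩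
  rcases Finset.mem_union.1 (hu ▸ Finset.mem_union_left B hv : v ∈ A' ∪ B') with hv' | hv'
  · exact hv'
  · have h1 := h'.lt m hmA' v hv'
    have h2 := h.lt v hv x hxB
    have h3 := topDiff_isosceles h1.ne (h1.trans h2).ne h2.ne
    have h4 := h.eq v hv x hxB
    have h5 := h'.eq m hmA' v hv'
    have h6 := h.eq m hmA x hxB
    omega

lemma unique (h : IsSplit A B r) (h' : IsSplit A' B' r') (hu : A ∪ B = A' ∪ B') :
    A = A' ∧ B = B' ∧ r = r' := by
  obtain ⟨h1, h2⟩ := h.level_eq h' hu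
  obtain ⟨_, h3⟩ := h'.level_eq h hu.symm
  have hA := h2.antisymm h3
  subst hA
  refine ⟨rfl, ?_, h1⟩
  rw [← Finset.union_sdiff_cancel_left h.disjoint, hu, Finset.union_sdiff_cancel_left h'.disjoint]

lemma card_eq_one_of_isComb (h : IsSplit A B r) (hc : IsComb (A ∪ B)) :
    A.card = 1 ∨ B.card = 1 := by
  obtain ⟨p, hp, hinj⟩ := hc
  rcases Finset.mem_union.1 hp with hp | hp
  · right
    obtain ⟨hpB, hconst⟩ := h.const_right hp
    refine le_antisymm (Finset.card_le_one.2 fun a ha b hb => ?_) h.right_nonempty.card_pos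
    refine hinj ?_ ?_ (by simp only [hconst a ha, hconst b hb]) <;>
      simp only [Finset.coe_erase, Set.mem_sdiff, Finset.mem_coe, Finset.mem_union,
        Set.mem_singleton_iff]
    · exact ⟨Or.inr ha, fun hh => hpB (hh ▸ ha)⟩
    · exact ⟨Or.inr hb, fun hh => hpB (hh ▸ hb)⟩
  · left
    obtain ⟨hpA, hconst⟩ := h.const_left hp
    refine le_antisymm (Finset.card_le_one.2 fun a ha b hb => ?_) h.left_nonempty.card_pos
    refine hinj ?_ ?_ (by simp only [hconst a ha, hconst b hb]) <;>
      simp only [Finset.coe_erase, Set.mem_sdiff, Finset.mem_coe, Finset.mem_union,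
        Set.mem_singleton_iff]
    · exact ⟨Or.inl ha, fun hh => hpA (hh ▸ ha)⟩
    · exact ⟨Or.inl hb, fun hh => hpA (hh ▸ hb)⟩

end IsSplit

lemma exists_isSplit {S : Finset ℕ} (hS : 2 ≤ S.card) :
    ∃ A B r, IsSplit A B r ∧ A ∪ B = S := by
  classical
  have hne : S.Nonempty := Finset.card_pos.1 (by omega)
  have hlt : S.min' hne < S.max' hne := Finset.min'_lt_max'_of_card S hS
  set m := S.min' hne
  set x := S.max' hne
  have hm : m ∈ S := S.min'_mem hne
  have hx : x ∈ S := S.max'_mem hne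
  have hmle : ∀ v ∈ S, m ≤ v := fun v hv => S.min'_le v hv
  have hxle : ∀ v ∈ S, v ≤ x := fun v hv => S.le_max' v hv
  refine ⟨S.filter fun v => v ≠ x ∧ topDiff v x = topDiff m x,
    S.filter fun v => ¬ (v ≠ x ∧ topDiff v x = topDiff m x), topDiff m x,
    ⟨⟨m, by simp [hm, hlt.ne]⟩, ⟨x, by simp [hx]⟩, ?_, ?_⟩, Finset.filter_union_filter_not_eq _ _⟩
  all_goals
    intro a ha b hb
    simp only [Finset.mem_filter, not_and] at ha hb
    obtain ⟨haS, hax, had⟩ := ha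
    obtain ⟨hbS, hbd⟩ := hb
    by_cases hbx : b = x
    · subst hbx
      first
      | exact lt_of_le_of_ne (hxle a haS) hax
      | exact had
    have hbd := hbd hbx
    have hax' := lt_of_le_of_ne (hxle a haS) hax
    have hbx' := lt_of_le_of_ne (hxle b hbS) hbx
    have hab : a ≠ b := by rintro rfl; exact hbd had
    have h1 := topDiff_isosceles hab hax hbx
    have hmb : m ≠ b := by rintro hh; exact hbd (by rw [← hh])
    have h2 := topDiff_trans_of_lt (lt_of_le_of_ne (hmle b hbS) hmb) hbx'
    first
    | (rcases lt_or_gt_of_ne hab with h3 | h3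
       · exact h3
       · have h4 := topDiff_trans_of_lt h3 hax'
         have h5 := topDiff_ne_of_lt h3 hax'
         omega)
    | omega

/-- A tree is a caterpillar or spans two disjoint large subtrees, or is small. -/
lemma exists_isSplit_or_isComb {c : ℕ} (hc : 1 ≤ c) (W : Finset ℕ) (hW : W.Nonempty) :
    (∃ A B r, IsSplit A B r ∧ A ∪ B ⊆ W ∧ c ≤ A.card ∧ c ≤ B.card) ∨
    ∃ Q ⊆ W, IsComb Q ∧ W.card ≤ c * Q.card := by
  classical
  induction W using Finset.strongInduction with
  | H W ih =>
    by_cases h2 : 2 ≤ W.card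
    · obtain ⟨A, B, r, hs, rfl⟩ := exists_isSplit h2
      have hcard := hs.card_union
      have hApos := hs.left_nonempty.card_pos
      have hBpos := hs.right_nonempty.card_pos
      by_cases hA : c ≤ A.card
      · by_cases hB : c ≤ B.card
        · exact Or.inl ⟨A, B, r, hs, subset_rfl, hA, hB⟩
        · have hss : A ⊂ A ∪ B := Finset.ssubset_of_subset_of_ssubset subset_rfl
            ⟨Finset.subset_union_left, fun h => by have := Finset.card_le_card h; omega⟩
          rcases ih A hss hs.left_nonempty with ⟨A', B', r', h1, h2, h3⟩ | ⟨Q, hQ, hQc, hle⟩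
          · exact Or.inl ⟨A', B', r', h1, h2.trans hss.subset, h3⟩
          · obtain ⟨b, hb⟩ := hs.right_nonempty
            obtain ⟨hbA, hconst⟩ := hs.const_left hb
            have hbQ : b ∉ Q := fun h => hbA (hQ h)
            refine Or.inr ⟨insert b Q, Finset.insert_subset (Finset.mem_union_right _ hb)
              (hQ.trans hss.subset), hQc.insert_of_const hbQ fun u hu => hconst u (hQ hu), ?_⟩
            rw [Finset.card_insert_of_notMem hbQ, mul_add]
            omega
      · have hss : B ⊂ A ∪ B := Finset.ssubset_of_subset_of_ssubset subset_rfl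
            ⟨Finset.subset_union_right, fun h => by have := Finset.card_le_card h; omega⟩
        rcases ih B hss hs.right_nonempty with ⟨A', B', r', h1, h2, h3⟩ | ⟨Q, hQ, hQc, hle⟩
        · exact Or.inl ⟨A', B', r', h1, h2.trans hss.subset, h3⟩
        · obtain ⟨a, ha⟩ := hs.left_nonempty
          obtain ⟨haB, hconst⟩ := hs.const_right ha
          have haQ : a ∉ Q := fun h => haB (hQ h)
          refine Or.inr ⟨insert a Q, Finset.insert_subset (Finset.mem_union_left _ ha)
            (hQ.trans hss.subset), hQc.insert_of_const haQ fun u hu => hconst u (hQ hu), ?_⟩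
          rw [Finset.card_insert_of_notMem haQ, mul_add]
          omega
    · obtain ⟨a, ha⟩ := hW
      refine Or.inr ⟨{a}, by simpa using ha, isComb_singleton a, ?_⟩
      simp only [Finset.card_singleton]
      omega

lemma exists_isComb_of_two_pow_le (j : ℕ) (S : Finset ℕ) (hS : 2 ^ j ≤ S.card) :
    ∃ Q ⊆ S, IsComb Q ∧ j + 1 ≤ Q.card := by
  classical
  induction j generalizing S with
  | zero =>
    obtain ⟨a, ha⟩ := Finset.card_pos.1 (lt_of_lt_of_le (by norm_num) hS)
    exact ⟨{a}, by simpa using ha, isComb_singleton a, by simp⟩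
  | succ j ih =>
    have hpos : 1 ≤ 2 ^ j := Nat.one_le_two_pow
    rw [pow_succ] at hS
    obtain ⟨A, B, r, hs, rfl⟩ := exists_isSplit (S := S) (by omega)
    have hcard := hs.card_union
    by_cases hA : 2 ^ j ≤ A.card
    · obtain ⟨Q, hQ, hQc, hle⟩ := ih A hA
      obtain ⟨b, hb⟩ := hs.right_nonempty
      obtain ⟨hbA, hconst⟩ := hs.const_left hb
      have hbQ : b ∉ Q := fun h => hbA (hQ h)
      refine ⟨insert b Q, Finset.insert_subset (Finset.mem_union_right _ hb)
        (hQ.trans Finset.subset_union_left),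
        hQc.insert_of_const hbQ fun u hu => hconst u (hQ hu), ?_⟩
      rw [Finset.card_insert_of_notMem hbQ]
      omega
    · obtain ⟨Q, hQ, hQc, hle⟩ := ih B (by omega)
      obtain ⟨a, ha⟩ := hs.left_nonempty
      obtain ⟨haB, hconst⟩ := hs.const_right ha
      have haQ : a ∉ Q := fun h => haB (hQ h)
      refine ⟨insert a Q, Finset.insert_subset (Finset.mem_union_left _ ha)
        (hQ.trans Finset.subset_union_right),
        hQc.insert_of_const haQ fun u hu => hconst u (hQ hu), ?_⟩
      rw [Finset.card_insert_of_notMem haQ]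
      omega

/-- A tree that is not a caterpillar spans a balanced tree with four leaves. -/
lemma exists_four_not_isComb (S : Finset ℕ) (hne : S.Nonempty) (hS : ¬ IsComb S) :
    ∃ Q ⊆ S, Q.card = 4 ∧ ∃ A B r, IsSplit A B r ∧ A ∪ B = Q ∧ A.card = 2 ∧ B.card = 2 := by
  classical
  induction S using Finset.strongInduction with
  | H S ih =>
    by_cases h2 : 2 ≤ S.card
    · obtain ⟨A, B, r, hs, rfl⟩ := exists_isSplit h2
      have hcard := hs.card_union
      have hApos := hs.left_nonempty.card_pos
      have hBpos := hs.right_nonempty.card_pos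
      by_cases hA : 2 ≤ A.card
      · by_cases hB : 2 ≤ B.card
        · obtain ⟨A', hA', hcA⟩ := Finset.exists_subset_card_eq hA
          obtain ⟨B', hB', hcB⟩ := Finset.exists_subset_card_eq hB
          have hs' := hs.mono hA' hB' (Finset.card_pos.1 (by omega)) (Finset.card_pos.1 (by omega))
          exact ⟨A' ∪ B', Finset.union_subset_union hA' hB', by rw [hs'.card_union, hcA, hcB],
            A', B', r, hs', rfl, hcA, hcB⟩
        · obtain ⟨b, rfl⟩ := Finset.card_eq_one.1 (by omega : B.card = 1)
          obtain ⟨hbA, hconst⟩ := hs.const_left (Finset.mem_singleton_self b)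
          have hss : A ⊂ A ∪ {b} :=
            ⟨Finset.subset_union_left, fun h => by have := Finset.card_le_card h; omega⟩
          obtain ⟨Q, hQ, h⟩ := ih A hss hs.left_nonempty fun hA => hS (by
            rw [Finset.union_comm]; exact hA.insert_of_const hbA hconst)
          exact ⟨Q, hQ.trans hss.subset, h⟩
      · obtain ⟨a, rfl⟩ := Finset.card_eq_one.1 (by omega : A.card = 1)
        obtain ⟨haB, hconst⟩ := hs.const_right (Finset.mem_singleton_self a)
        have hss : B ⊂ {a} ∪ B :=
          ⟨Finset.subset_union_right, fun h => by have := Finset.card_le_card h; omega⟩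
        obtain ⟨Q, hQ, h⟩ := ih B hss hs.right_nonempty fun hB => hS
          (hB.insert_of_const haB hconst)
        exact ⟨Q, hQ.trans hss.subset, h⟩
    · obtain ⟨a, rfl⟩ := Finset.card_eq_one.1 (le_antisymm (by omega) hne.card_pos)
      exact absurd (isComb_singleton a) hS
/-- A `k`-uniform hypergraph on `{0,…,M-1}` without `K_{k+2}` in which every `n` vertices span a
`K_{k+1}`, together with a link property `F` that fails somewhere on the link of each vertex
of an edge, but holds somewhere on any `c` vertices. -/
structure IsGood (k c n M : ℕ) (E : Finset ℕ → Prop) (F : ℕ → Finset ℕ → Prop) : Prop where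
  cliqueFree : ∀ T ⊆ Finset.range M, T.card = k + 2 → ∃ e ⊆ T, e.card = k ∧ ¬ E e
  exists_clique : ∀ W ⊆ Finset.range M, n ≤ W.card →
    ∃ S ⊆ W, S.card = k + 1 ∧ ∀ e ⊆ S, e.card = k → E e
  exists_not_link : ∀ e ⊆ Finset.range M, e.card = k → E e → ∀ r ∈ e,
    ∃ B ⊆ e.erase r, B.card = k - 2 ∧ ¬ F r B
  exists_link : ∀ r < M, ∀ B ⊆ Finset.range M, r ∉ B → c ≤ B.card →
    ∃ B' ⊆ B, B'.card = k - 2 ∧ F r B'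

/-- The stepped-up `(k+1)`-uniform hypergraph. -/
def stepEdge (k : ℕ) (E : Finset ℕ → Prop) (F : ℕ → Finset ℕ → Prop) (S : Finset ℕ) : Prop :=
  (IsComb S ∧ E (diffSet S)) ∨ ∃ A B r, IsSplit A B r ∧ A ∪ B = S ∧
    ((A.card = 2 ∧ F r (diffSet B)) ∨ (A.card = 3 ∧ (k = 4 → F r (diffSet A))))

/-- The stepped-up link property. -/
def stepLink (F : ℕ → Finset ℕ → Prop) (v : ℕ) (B : Finset ℕ) : Prop :=
  (∃ r, (∀ u ∈ B, topDiff u v = r) ∧ IsComb B ∧ F r (diffSet B)) ∨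
  (Set.InjOn (fun u => topDiff u v) (B : Set ℕ) ∧
    F ((B.image fun u => topDiff u v).sup id)
      ((B.image fun u => topDiff u v).erase ((B.image fun u => topDiff u v).sup id)))

lemma stepLink.isComb {F : ℕ → Finset ℕ → Prop} {v : ℕ} {B : Finset ℕ} (h : stepLink F v B)
    (hv : v ∉ B) : IsComb (insert v B) := by
  rcases h with ⟨r, hr, hB, _⟩ | ⟨hinj, _⟩
  · exact hB.insert_of_const hv hr
  · exact ⟨v, Finset.mem_insert_self _ _, by rwa [Finset.erase_insert hv]⟩

section Step

variable {k c n M : ℕ} {E : Finset ℕ → Prop} {F : ℕ → Finset ℕ → Prop}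

lemma stepEdge.of_isComb (hk : 4 ≤ k) {S : Finset ℕ} (h : stepEdge k E F S)
    (hS : S.card = k + 1) (hc : IsComb S) : E (diffSet S) := by
  rcases h with h | ⟨A, B, r, hs, rfl, h⟩
  · exact h.2
  · have h1 := hs.card_eq_one_of_isComb hc
    have h2 := hs.card_union
    rcases h with h | h <;> omega

lemma stepEdge.of_isSplit {A B : Finset ℕ} {r : ℕ} (h : stepEdge k E F (A ∪ B))
    (hs : IsSplit A B r) (hA : 2 ≤ A.card) (hB : 2 ≤ B.card) :
    (A.card = 2 ∧ F r (diffSet B)) ∨ (A.card = 3 ∧ (k = 4 → F r (diffSet A))) := by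
  rcases h with h | ⟨A', B', r', hs', hu, h⟩
  · have := hs.card_eq_one_of_isComb h.1
    omega
  · obtain ⟨rfl, rfl, rfl⟩ := hs'.unique hs hu
    exact h

lemma stepEdge.isComb_of_isSplit (hk : 4 ≤ k) {A B : Finset ℕ} {r : ℕ}
    (h : stepEdge k E F (A ∪ B)) (hs : IsSplit A B r) (hc : A.card + B.card = k + 1)
    (h1 : A.card = 1 ∨ B.card = 1) : IsComb (A ∪ B) ∧ E (diffSet (A ∪ B)) := by
  rcases h with h | ⟨A', B', r', hs', hu, h⟩
  · exact h
  · obtain ⟨rfl, rfl, rfl⟩ := hs'.unique hs hu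
    rcases h with h | h <;> omega

lemma IsGood.stepLink_not_of_cone (hG : IsGood k c n M E F) (hk : 4 ≤ k) {A : Finset ℕ}
    {v r : ℕ} (hA : A.card = k) (hv : v ∉ A) (hr : ∀ u ∈ A, topDiff u v = r)
    (hc : IsComb (insert v A)) (hE : E (diffSet (insert v A)))
    (hM : insert v A ⊆ Finset.range (2 ^ M)) :
    ∃ B ⊆ A, B.card = k - 1 ∧ ¬ F r (diffSet B) := by
  have hAne : A.Nonempty := Finset.card_pos.1 (by omega)
  have hcA : IsComb A := hc.subset (Finset.subset_insert _ _) hAne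
  have hd := diffSet_insert_of_const hAne hv hr
  have hrA := notMem_diffSet_of_const hv hr
  have hcard := hc.card_diffSet
  rw [Finset.card_insert_of_notMem hv] at hcard
  obtain ⟨e, he, hec, hF⟩ := hG.exists_not_link _ (diffSet_subset_range hM) (by omega) hE r
    (by rw [hd]; exact Finset.mem_insert_self _ _)
  rw [hd, Finset.erase_insert hrA] at he
  obtain ⟨B, hB, _, hBe, hBc⟩ := hcA.exists_subset he
  exact ⟨B, hB, by omega, by rwa [hBe]⟩

lemma IsGood.step_cliqueFree (hG : IsGood k c n M E F) (hk : 4 ≤ k) (T : Finset ℕ)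
    (hT : T ⊆ Finset.range (2 ^ M)) (hTc : T.card = k + 3) :
    ∃ e ⊆ T, e.card = k + 1 ∧ ¬ stepEdge k E F e := by
  classical
  by_contra! hcl
  by_cases hcomb : IsComb T
  · have h1 := hcomb.card_diffSet
    obtain ⟨e, he, hec, hE⟩ := hG.cliqueFree _ (diffSet_subset_range hT) (by omega)
    obtain ⟨S, hS, hSc, hSe, hcard⟩ := hcomb.exists_subset he
    refine hE (hSe ▸ (hcl S hS (by omega)).of_isComb hk (by omega) hSc)
  obtain ⟨A, B, r, hs, rfl⟩ := exists_isSplit (S := T) (by omega)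
  have hcard := hs.card_union
  have hApos := hs.left_nonempty.card_pos
  have hBpos := hs.right_nonempty.card_pos
  have hsub : ∀ A' ⊆ A, ∀ B' ⊆ B, A' ∪ B' ⊆ A ∪ B :=
    fun A' hA B' hB => Finset.union_subset_union hA hB
  have hedge : ∀ A' ⊆ A, ∀ B' ⊆ B, 1 ≤ A'.card → 1 ≤ B'.card → A'.card + B'.card = k + 1 →
      IsSplit A' B' r ∧ stepEdge k E F (A' ∪ B') := by
    intro A' hA B' hB h1 h2 h3
    have hs' := hs.mono hA hB (Finset.card_pos.1 h1) (Finset.card_pos.1 h2)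
    exact ⟨hs', hcl _ (hsub A' hA B' hB) (by rw [hs'.card_union, h3])⟩
  by_cases hA1 : A.card = 1
  · obtain ⟨a, rfl⟩ := Finset.card_eq_one.1 hA1
    obtain ⟨haB, hconst⟩ := hs.const_right (Finset.mem_singleton_self a)
    have hBnc : ¬ IsComb B := fun h => hcomb (h.insert_of_const haB hconst)
    obtain ⟨Q, hQ, hQc, C, D, t, hs', rfl, hC, hD⟩ :=
      exists_four_not_isComb B hs.right_nonempty hBnc
    obtain ⟨B', hQB', hB', hB'c⟩ := Finset.exists_subsuperset_card_eq (n := k) hQ (by omega)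
      (by omega)
    obtain ⟨hs2, he⟩ := hedge _ subset_rfl B' hB' (by omega) (by omega) (by omega)
    have := (he.isComb_of_isSplit hk hs2 (by omega) (by omega)).1
    have h4 := hs'.card_eq_one_of_isComb
      (this.subset (hQB'.trans Finset.subset_union_right) (Finset.card_pos.1 (by omega)))
    omega
  by_cases hB1 : B.card = 1
  · obtain ⟨b, rfl⟩ := Finset.card_eq_one.1 hB1
    obtain ⟨hbA, hconst⟩ := hs.const_left (Finset.mem_singleton_self b)
    have hAnc : ¬ IsComb A := fun h => hcomb (by
      rw [Finset.union_comm]; exact h.insert_of_const hbA hconst)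
    obtain ⟨Q, hQ, hQc, C, D, t, hs', rfl, hC, hD⟩ :=
      exists_four_not_isComb A hs.left_nonempty hAnc
    obtain ⟨A', hQA', hA', hA'c⟩ := Finset.exists_subsuperset_card_eq (n := k) hQ (by omega)
      (by omega)
    obtain ⟨hs2, he⟩ := hedge A' hA' _ subset_rfl (by omega) (by omega) (by omega)
    have := (he.isComb_of_isSplit hk hs2 (by omega) (by omega)).1
    have h4 := hs'.card_eq_one_of_isComb
      (this.subset (hQA'.trans Finset.subset_union_left) (Finset.card_pos.1 (by omega)))
    omega
  by_cases hBk : k ≤ B.card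
  · obtain ⟨a, ha⟩ := hs.left_nonempty
    obtain ⟨B', hB', hB'c⟩ := Finset.exists_subset_card_eq hBk
    obtain ⟨hs2, he⟩ := hedge {a} (by simpa using ha) B' hB' (by simp) (by omega)
      (by rw [Finset.card_singleton]; omega)
    obtain ⟨haB, hconst⟩ := hs2.const_right (Finset.mem_singleton_self a)
    obtain ⟨h1, h2⟩ := he.isComb_of_isSplit hk hs2 (by rw [Finset.card_singleton]; omega)
      (by simp)
    obtain ⟨B'', hB'', hB''c, hF⟩ := hG.stepLink_not_of_cone hk hB'c haB hconst h1 h2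
      ((hsub _ (Finset.singleton_subset_iff.2 ha) _ hB').trans hT)
    obtain ⟨A', hA', hA'c⟩ := Finset.exists_subset_card_eq (by omega : 2 ≤ A.card)
    obtain ⟨hs3, he3⟩ := hedge A' hA' B'' (hB''.trans hB') (by omega) (by omega) (by omega)
    rcases he3.of_isSplit hs3 (by omega) (by omega) with h | h
    · exact hF h.2
    · omega
  by_cases hk4 : k = 4
  · obtain ⟨b, hb⟩ := hs.right_nonempty
    obtain ⟨A', hA', hA'c⟩ := Finset.exists_subset_card_eq (by omega : k ≤ A.card)
    obtain ⟨hs2, he⟩ := hedge A' hA' {b} (by simpa using hb) (by omega) (by simp)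
      (by rw [Finset.card_singleton]; omega)
    obtain ⟨hbA, hconst⟩ := hs2.const_left (Finset.mem_singleton_self b)
    obtain ⟨h1, h2⟩ := he.isComb_of_isSplit hk hs2 (by rw [Finset.card_singleton]; omega)
      (by simp)
    have hcup := hsub _ hA' _ (Finset.singleton_subset_iff.2 hb)
    rw [Finset.union_comm] at h1 h2 hcup
    obtain ⟨A'', hA'', hA''c, hF⟩ := hG.stepLink_not_of_cone hk hA'c hbA hconst h1 h2
      (hcup.trans hT)
    obtain ⟨B', hB', hB'c⟩ := Finset.exists_subset_card_eq (by omega : 2 ≤ B.card)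
    obtain ⟨hs3, he3⟩ := hedge A'' (hA''.trans hA') B' hB' (by omega) (by omega) (by omega)
    rcases he3.of_isSplit hs3 (by omega) (by omega) with h | h
    · omega
    · exact hF (h.2 hk4)
  · obtain ⟨x, hx1, hx2, hx3⟩ : ∃ x, 4 ≤ x ∧ x ≤ A.card ∧ 2 ≤ k + 1 - x ∧ k + 1 - x ≤ B.card :=
      ⟨max 4 (A.card - 2), by omega⟩
    obtain ⟨A', hA', hA'c⟩ := Finset.exists_subset_card_eq hx2
    obtain ⟨B', hB', hB'c⟩ := Finset.exists_subset_card_eq hx3.2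
    obtain ⟨hs3, he3⟩ := hedge A' hA' B' hB' (by omega) (by omega) (by omega)
    rcases he3.of_isSplit hs3 (by omega) (by omega) with h | h <;> omega

lemma IsGood.exists_subset_link (hG : IsGood k c n M E F) (hk : 4 ≤ k) {B : Finset ℕ} {v r : ℕ}
    (hv : v ∉ B) (hr : ∀ u ∈ B, topDiff u v = r) (hB : 2 ^ c ≤ B.card) (hvM : v < 2 ^ M)
    (hBM : B ⊆ Finset.range (2 ^ M)) :
    ∃ B' ⊆ B, B'.card = k - 1 ∧ IsComb B' ∧ F r (diffSet B') := by
  obtain ⟨Q, hQ, hQc, hle⟩ := exists_isComb_of_two_pow_le c B hB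
  have h1 := hQc.card_diffSet
  have hrM : r < M := by
    obtain ⟨u, hu⟩ := Finset.card_pos.1 (lt_of_lt_of_le (by positivity) hB)
    rw [← hr u hu]
    exact topDiff_lt (fun h => hv (h ▸ hu)) (Finset.mem_range.1 (hBM hu)) hvM
  obtain ⟨e, he, hec, hF⟩ := hG.exists_link r hrM (diffSet Q)
    (diffSet_subset_range (hQ.trans hBM))
    (notMem_diffSet_of_const (fun h => hv (hQ h)) fun u hu => hr u (hQ hu)) (by omega)
  obtain ⟨B', hB', hc, hBe, hcard⟩ := hQc.exists_subset he
  exact ⟨B', hB'.trans hQ, by omega, hc, by rwa [hBe]⟩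

lemma IsGood.step_exists_clique (hG : IsGood k c n M E F) (hk : 4 ≤ k) (W : Finset ℕ)
    (hW : W ⊆ Finset.range (2 ^ M)) (hWc : (2 ^ c + 3) * (n + 1) ≤ W.card) :
    ∃ S ⊆ W, S.card = k + 2 ∧ ∀ e ⊆ S, e.card = k + 1 → stepEdge k E F e := by
  classical
  have hWne : W.Nonempty := Finset.card_pos.1 (lt_of_lt_of_le (by positivity) hWc)
  rcases exists_isSplit_or_isComb (c := 2 ^ c + 3) (Nat.le_add_left 1 (2 ^ c + 2)) W hWne with
    ⟨A, B, r, hs, hAB, hA, hB⟩ | ⟨Q, hQ, hQc, hle⟩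
  · have hpos : 1 ≤ 2 ^ c := Nat.one_le_two_pow
    have hAW := Finset.union_subset_left hAB
    have hBW := Finset.union_subset_right hAB
    obtain ⟨a, ha⟩ := hs.left_nonempty
    obtain ⟨b, hb⟩ := hs.right_nonempty
    obtain ⟨B', hB', hB'c, _, hFB⟩ := hG.exists_subset_link hk (hs.const_right ha).1
      (hs.const_right ha).2 (by omega) (Finset.mem_range.1 (hW (hAW ha))) (hBW.trans hW)
    obtain ⟨A', hA', hA'c, hFA⟩ : ∃ A' ⊆ A, A'.card = 3 ∧ (k = 4 → F r (diffSet A')) := by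
      by_cases hk4 : k = 4
      · obtain ⟨A', hA', hA'c, _, hFA⟩ := hG.exists_subset_link hk (hs.const_left hb).1
          (hs.const_left hb).2 (by omega) (Finset.mem_range.1 (hW (hBW hb))) (hAW.trans hW)
        exact ⟨A', hA', by omega, fun _ => hFA⟩
      · obtain ⟨A', hA', hA'c⟩ := Finset.exists_subset_card_eq (by
          omega : 3 ≤ A.card)
        exact ⟨A', hA', hA'c, fun h => absurd h hk4⟩
    have hs' := hs.mono hA' hB' (Finset.card_pos.1 (by omega)) (Finset.card_pos.1 (by omega))
    refine ⟨A' ∪ B', (Finset.union_subset_union hA' hB').trans hAB,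
      by rw [hs'.card_union]; omega, fun e he hec => ?_⟩
    have hsplit : (A' ∩ e) ∪ (B' ∩ e) = e := by
      rw [← Finset.union_inter_distrib_right]; exact Finset.inter_eq_right.2 he
    have hdisj : Disjoint (A' ∩ e) (B' ∩ e) :=
      hs'.disjoint.mono Finset.inter_subset_left Finset.inter_subset_left
    have hcard := Finset.card_union_of_disjoint hdisj
    rw [hsplit] at hcard
    have hA2 := Finset.card_le_card (Finset.inter_subset_left : A' ∩ e ⊆ A')
    have hB2 := Finset.card_le_card (Finset.inter_subset_left : B' ∩ e ⊆ B')
    have hs2 := hs'.mono (Finset.inter_subset_left : A' ∩ e ⊆ A')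
      (Finset.inter_subset_left : B' ∩ e ⊆ B') (Finset.card_pos.1 (by omega))
      (Finset.card_pos.1 (by omega))
    refine Or.inr ⟨_, _, r, hs2, hsplit, ?_⟩
    by_cases h3 : (A' ∩ e).card = 3
    · have : A' ∩ e = A' := Finset.eq_of_subset_of_card_le Finset.inter_subset_left (by omega)
      exact Or.inr ⟨h3, by rwa [this]⟩
    · have : B' ∩ e = B' := Finset.eq_of_subset_of_card_le Finset.inter_subset_left (by omega)
      exact Or.inl ⟨by omega, by rwa [this]⟩
  · have hQn : n + 1 ≤ Q.card := Nat.le_of_mul_le_mul_left (hWc.trans hle) (by positivity)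
    have h1 := hQc.card_diffSet
    obtain ⟨P, hP, hPc, hPE⟩ := hG.exists_clique (diffSet Q)
      (diffSet_subset_range (hQ.trans hW)) (by omega)
    obtain ⟨S, hS, hSc, hSP, hcard⟩ := hQc.exists_subset hP
    refine ⟨S, hS.trans hQ, by omega, fun e he hec => Or.inl ?_⟩
    have hec' : IsComb e := hSc.subset he (Finset.card_pos.1 (by omega))
    have h2 := hec'.card_diffSet
    exact ⟨hec', hPE _ (hSP ▸ diffSet_mono he) (by omega)⟩

lemma IsGood.step_exists_not_link (hG : IsGood k c n M E F) (hk : 4 ≤ k) (S : Finset ℕ)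
    (hS : S ⊆ Finset.range (2 ^ M)) (hSc : S.card = k + 1) (hE : stepEdge k E F S)
    (v : ℕ) (hv : v ∈ S) : ∃ B ⊆ S.erase v, B.card = k - 1 ∧ ¬ stepLink F v B := by
  classical
  have hAc : (S.erase v).card = k := by rw [Finset.card_erase_of_mem hv]; omega
  rcases hE with ⟨hc, hE⟩ | ⟨A, B, r, hs, rfl, h⟩
  · by_cases hconst : ∃ r, ∀ u ∈ S.erase v, topDiff u v = r
    · obtain ⟨r, hr⟩ := hconst
      have hins := Finset.insert_erase hv
      obtain ⟨B, hB, hBc, hF⟩ := hG.stepLink_not_of_cone hk hAc (Finset.notMem_erase v S) hr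
        (by rwa [hins]) (by rwa [hins]) (by rwa [hins])
      refine ⟨B, hB, hBc, ?_⟩
      rintro (⟨r', hr', _, hF'⟩ | ⟨hinj, _⟩)
      · obtain ⟨u, hu⟩ := Finset.card_pos.1 (by omega : 0 < B.card)
        have : r' = r := by rw [← hr' u hu, hr u (hB hu)]
        exact hF (this ▸ hF')
      · obtain ⟨a, ha, b, hb, hab⟩ := Finset.one_lt_card.1 (by omega : 1 < B.card)
        exact hab (hinj ha hb (by simp only [hr a (hB ha), hr b (hB hb)]))
    by_cases hinj : Set.InjOn (fun u => topDiff u v) (S.erase v : Finset ℕ)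
    · have hpiv : IsPivot S v := ⟨hv, hinj⟩
      have hdc := hc.card_diffSet
      have hne : (diffSet S).Nonempty := Finset.card_pos.1 (by omega)
      obtain ⟨r, hrD, hrsup⟩ := Finset.exists_mem_eq_sup _ hne id
      simp only [id] at hrsup
      obtain ⟨e, he, hec, hF⟩ := hG.exists_not_link _ (diffSet_subset_range hS) (by omega) hE r hrD
      have hre : r ∉ e := fun h => Finset.notMem_erase r _ (he h)
      have heD : insert r e ⊆ diffSet S :=
        Finset.insert_subset hrD (he.trans (Finset.erase_subset _ _))
      obtain ⟨T, hT, hvT, hTp, hTd⟩ := hpiv.exists_subset heD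
      have hTc := IsComb.card_diffSet ⟨v, hTp⟩
      rw [hTd, Finset.card_insert_of_notMem hre] at hTc
      have hBc : (T.erase v).card = k - 1 := by rw [Finset.card_erase_of_mem hvT]; omega
      have himg := hTp.diffSet_eq
      rw [hTd] at himg
      refine ⟨T.erase v, Finset.erase_subset_erase v hT, hBc, ?_⟩
      rintro (⟨r', hr', _, _⟩ | ⟨_, hF'⟩)
      · obtain ⟨a, ha, b, hb, hab⟩ := Finset.one_lt_card.1 (by omega : 1 < (T.erase v).card)
        exact hab (hTp.2 ha hb (by simp only [hr' a ha, hr' b hb]))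
      · have hsup : (insert r e).sup id = r := by
          apply le_antisymm
          · exact (Finset.sup_mono heD).trans hrsup.le
          · exact Finset.le_sup (f := id) (Finset.mem_insert_self r e)
        rw [← himg, hsup, Finset.erase_insert hre] at hF'
        exact hF hF'
    · simp only [Set.InjOn, Finset.mem_coe, not_forall] at hinj
      obtain ⟨a, ha, b, hb, hab, hne⟩ := hinj
      push Not at hconst
      obtain ⟨d, hd, hdne⟩ := hconst (topDiff a v)
      have hsub : ({a, b, d} : Finset ℕ) ⊆ S.erase v := by
        intro x hx
        simp only [Finset.mem_insert, Finset.mem_singleton] at hx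
        rcases hx with rfl | rfl | rfl <;> assumption
      obtain ⟨B, hB1, hB2, hBc⟩ := Finset.exists_subsuperset_card_eq (n := k - 1) hsub
        (Finset.card_le_three.trans (by omega)) (by omega)
      have haB : a ∈ B := hB1 (by simp)
      have hbB : b ∈ B := hB1 (by simp)
      have hdB : d ∈ B := hB1 (by simp)
      refine ⟨B, hB2, hBc, ?_⟩
      rintro (⟨r', hr', _, _⟩ | ⟨hinj, _⟩)
      · exact hdne (by rw [hr' a haB, hr' d hdB])
      · exact hne (hinj haB hbB hab)
  · have hcard := hs.card_union
    obtain ⟨w, hw, hwv, hA2, hB2⟩ : ∃ w ∈ A ∪ B, w ≠ v ∧ 2 ≤ (A.erase w).card ∧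
        2 ≤ (B.erase w).card := by
      by_cases hA3 : 3 ≤ A.card
      · obtain ⟨w, hw, hwv⟩ := Finset.exists_mem_ne (by omega : 1 < A.card) v
        refine ⟨w, Finset.mem_union_left _ hw, hwv, ?_, ?_⟩
        · rw [Finset.card_erase_of_mem hw]; omega
        · rw [Finset.erase_eq_of_notMem (hs.const_right hw).1]; omega
      · obtain ⟨w, hw, hwv⟩ := Finset.exists_mem_ne (by omega : 1 < B.card) v
        refine ⟨w, Finset.mem_union_right _ hw, hwv, ?_, ?_⟩
        · rw [Finset.erase_eq_of_notMem (hs.const_left hw).1]; omega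
        · rw [Finset.card_erase_of_mem hw]; omega
    have hs' := hs.mono (Finset.erase_subset w A) (Finset.erase_subset w B)
      (Finset.card_pos.1 (by omega)) (Finset.card_pos.1 (by omega))
    have hwS : w ∈ (A ∪ B).erase v := Finset.mem_erase.2 ⟨hwv, hw⟩
    refine ⟨((A ∪ B).erase v).erase w, Finset.erase_subset _ _,
      by rw [Finset.card_erase_of_mem hwS]; omega, fun hl => ?_⟩
    have hcomb := hl.isComb (by simp)
    rw [Finset.erase_right_comm, Finset.insert_erase (Finset.mem_erase.2 ⟨hwv.symm, hv⟩),
      Finset.erase_union_distrib] at hcomb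
    have := hs'.card_eq_one_of_isComb hcomb
    omega

lemma IsGood.step_exists_link (hG : IsGood k c n M E F) (hk : 4 ≤ k) (v : ℕ) (hv : v < 2 ^ M)
    (B : Finset ℕ) (hB : B ⊆ Finset.range (2 ^ M)) (hvB : v ∉ B)
    (hBc : (c + 1) * 2 ^ c ≤ B.card) : ∃ B' ⊆ B, B'.card = k - 1 ∧ stepLink F v B' := by
  classical
  by_cases hD : c + 1 ≤ (B.image fun u => topDiff u v).card
  · obtain ⟨B₀, hB₀, hbij⟩ := Set.SurjOn.exists_bijOn_subset
      (s := (B : Set ℕ)) (t := ((B.image fun u => topDiff u v : Finset ℕ) : Set ℕ))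
      (f := fun u => topDiff u v) (by rw [Finset.coe_image]; exact Set.surjOn_image _ _)
    lift B₀ to Finset ℕ using B.finite_toSet.subset hB₀
    have hB₀' : B₀ ⊆ B := Finset.coe_subset.1 hB₀
    have hvB₀ : v ∉ B₀ := fun h => hvB (hB₀' h)
    have hpiv : IsPivot (insert v B₀) v :=
      ⟨Finset.mem_insert_self _ _, by rw [Finset.erase_insert hvB₀]; exact hbij.injOn⟩
    have himg : diffSet (insert v B₀) = B.image fun u => topDiff u v := by
      rw [hpiv.diffSet_eq, Finset.erase_insert hvB₀, ← Finset.coe_inj, Finset.coe_image]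
      exact hbij.image_eq
    rw [← himg] at hD
    have hDM : diffSet (insert v B₀) ⊆ Finset.range M :=
      diffSet_subset_range (Finset.insert_subset (Finset.mem_range.2 hv) (hB₀'.trans hB))
    obtain ⟨r, hrD, hrsup⟩ := Finset.exists_mem_eq_sup _ (Finset.card_pos.1 (by omega :
      0 < (diffSet (insert v B₀)).card)) id
    obtain ⟨e, he, hec, hF⟩ := hG.exists_link r (Finset.mem_range.1 (hDM hrD))
      ((diffSet (insert v B₀)).erase r) ((Finset.erase_subset _ _).trans hDM)
      (Finset.notMem_erase _ _) (by rw [Finset.card_erase_of_mem hrD]; omega)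
    have hre : r ∉ e := fun h => Finset.notMem_erase r _ (he h)
    have heD : insert r e ⊆ diffSet (insert v B₀) :=
      Finset.insert_subset hrD (he.trans (Finset.erase_subset _ _))
    obtain ⟨T, hT, hvT, hTp, hTd⟩ := hpiv.exists_subset heD
    have hTc := IsComb.card_diffSet ⟨v, hTp⟩
    rw [hTd, Finset.card_insert_of_notMem hre] at hTc
    have hTimg := hTp.diffSet_eq
    have hsup : (insert r e).sup id = r := le_antisymm ((Finset.sup_mono heD).trans hrsup.le)
      (Finset.le_sup (f := id) (Finset.mem_insert_self r e))
    refine ⟨T.erase v, ?_, by rw [Finset.card_erase_of_mem hvT]; omega, Or.inr ⟨hTp.2, ?_⟩⟩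
    · exact (Finset.erase_subset_erase v hT).trans (by rwa [Finset.erase_insert hvB₀])
    · rwa [← hTimg, hTd, hsup, Finset.erase_insert hre]
  · have hne : (B.image fun u => topDiff u v).Nonempty :=
      (Finset.card_pos.1 (lt_of_lt_of_le (by positivity) hBc)).image _
    obtain ⟨r, hr, hle⟩ := Finset.exists_le_card_fiber_of_mul_le_card_of_maps_to
      (s := B) (t := B.image fun u => topDiff u v) (f := fun u => topDiff u v) (n := 2 ^ c)
      (fun u hu => Finset.mem_image_of_mem _ hu) hne
      ((Nat.mul_le_mul_right _ (by omega)).trans hBc)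
    obtain ⟨B', hB', hB'c, hcomb, hF⟩ := hG.exists_subset_link hk (r := r)
      (B := B.filter fun u => topDiff u v = r) (fun h => hvB (Finset.mem_filter.1 h).1)
      (fun u hu => (Finset.mem_filter.1 hu).2) hle hv ((Finset.filter_subset _ _).trans hB)
    exact ⟨B', hB'.trans (Finset.filter_subset _ _), hB'c,
      Or.inl ⟨r, fun u hu => (Finset.mem_filter.1 (hB' hu)).2, hcomb, hF⟩⟩

/-- The stepping-up lemma. -/
lemma IsGood.step (hG : IsGood k c n M E F) (hk : 4 ≤ k) :
    IsGood (k + 1) ((c + 1) * 2 ^ c) ((2 ^ c + 3) * (n + 1)) (2 ^ M) (stepEdge k E F)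
      (stepLink F) where
  cliqueFree := hG.step_cliqueFree hk
  exists_clique := hG.step_exists_clique hk
  exists_not_link := hG.step_exists_not_link hk
  exists_link := hG.step_exists_link hk

end Step

/-- Overwrite `ω` by `π` on `Q`. -/
def overwrite {ι : Type*} [DecidableEq ι] (Q : Finset ι) (π ω : ι → Bool) : ι → Bool :=
  fun x => if x ∈ Q then π x else ω x

lemma card_le_two_pow_mul_card_filter_agree {ι : Type*} [Fintype ι] [DecidableEq ι]
    (Q : Finset ι) (π : ι → Bool) (A : Finset (ι → Bool))
    (hA : ∀ ω ∈ A, overwrite Q π ω ∈ A) :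
    A.card ≤ 2 ^ Q.card * (A.filter fun ω => ∀ x ∈ Q, ω x = π x).card := by
  classical
  refine Finset.card_le_mul_card_image_of_maps_to (f := overwrite Q π) ?_ _ ?_
  · intro ω hω
    refine Finset.mem_filter.2 ⟨hA ω hω, fun x hx => ?_⟩
    simp [overwrite, hx]
  · intro b _
    rw [← Finset.card_powerset]
    refine Finset.card_le_card_of_injOn (fun ω => Q.filter fun x => ω x = true) ?_ ?_
    · intro ω _
      simp only [Finset.coe_powerset, Set.mem_preimage, Set.mem_powerset_iff, Finset.coe_subset]
      exact Finset.filter_subset _ _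
    · intro ω hω ω' hω' h
      simp only [Finset.coe_filter, Set.mem_ofPred_eq] at hω hω'
      funext x
      by_cases hx : x ∈ Q
      · have := congrArg (fun s => x ∈ s) h
        simp only [Finset.mem_filter, hx, true_and, eq_iff_iff] at this
        exact Bool.eq_iff_iff.2 this
      · have := congrFun (hω.2.trans hω'.2.symm) x
        simpa [overwrite, hx] using this

lemma card_avoiding_mul_le {ι κ : Type*} [Fintype ι] [DecidableEq ι] [DecidableEq κ] {d : ℕ}
    (s : Finset κ) (Q : κ → Finset ι) (π : κ → ι → Bool)
    (hQ : ∀ i ∈ s, ∀ j ∈ s, i ≠ j → Disjoint (Q i) (Q j)) (hd : ∀ i ∈ s, (Q i).card ≤ d) :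
    (2 ^ d) ^ s.card *
        (Finset.univ.filter fun ω : ι → Bool => ∀ i ∈ s, ∃ x ∈ Q i, ω x ≠ π i x).card ≤
      (2 ^ d - 1) ^ s.card * 2 ^ Fintype.card ι := by
  classical
  induction s using Finset.induction_on with
  | empty => simp
  | insert a s ha ih =>
    have ih := ih (fun i hi j hj => hQ i (Finset.mem_insert_of_mem hi) j
      (Finset.mem_insert_of_mem hj)) (fun i hi => hd i (Finset.mem_insert_of_mem hi))
    set A := Finset.univ.filter fun ω : ι → Bool => ∀ i ∈ s, ∃ x ∈ Q i, ω x ≠ π i x with hA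
    have hov : ∀ ω ∈ A, overwrite (Q a) (π a) ω ∈ A := by
      intro ω hω
      refine Finset.mem_filter.2 ⟨Finset.mem_univ _, fun i hi => ?_⟩
      obtain ⟨x, hx, hne⟩ := (Finset.mem_filter.1 hω).2 i hi
      refine ⟨x, hx, ?_⟩
      have hdis := hQ i (Finset.mem_insert_of_mem hi) a (Finset.mem_insert_self _ _)
        (fun h => ha (h ▸ hi))
      simpa [overwrite, Finset.disjoint_left.1 hdis hx] using hne
    have h1 : A.card ≤ 2 ^ d * (A.filter fun ω => ∀ x ∈ Q a, ω x = π a x).card :=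
      (card_le_two_pow_mul_card_filter_agree (Q a) (π a) A hov).trans
        (Nat.mul_le_mul_right _ (Nat.pow_le_pow_right two_pos (hd a (Finset.mem_insert_self _ _))))
    have h2 := Finset.card_filter_add_card_filter_not (s := A)
      (fun ω : ι → Bool => ∀ x ∈ Q a, ω x = π a x)
    have h3 : (Finset.univ.filter fun ω : ι → Bool =>
        ∀ i ∈ insert a s, ∃ x ∈ Q i, ω x ≠ π i x) =
        A.filter fun ω => ¬ ∀ x ∈ Q a, ω x = π a x := by
      ext ω
      simp [hA, and_comm]
    rw [h3, Finset.card_insert_of_notMem ha]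
    set b := (A.filter fun ω => ¬ ∀ x ∈ Q a, ω x = π a x).card
    set c := (A.filter fun ω => ∀ x ∈ Q a, ω x = π a x).card
    obtain ⟨D, hD⟩ : ∃ D, 2 ^ d = D + 1 := ⟨2 ^ d - 1, (Nat.sub_add_cancel Nat.one_le_two_pow).symm⟩
    rw [hD] at h1 ih ⊢
    simp only [Nat.add_sub_cancel] at ih ⊢
    have h4 : (D + 1) * b ≤ D * A.card := by nlinarith
    calc (D + 1) ^ (s.card + 1) * b = (D + 1) ^ s.card * ((D + 1) * b) := by ring
      _ ≤ (D + 1) ^ s.card * (D * A.card) := Nat.mul_le_mul_left _ h4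
      _ = D * ((D + 1) ^ s.card * A.card) := by ring
      _ ≤ D * (D ^ s.card * 2 ^ Fintype.card ι) := Nat.mul_le_mul_left _ ih
      _ = _ := by ring

lemma two_mul_pow_le (n : ℕ) : 2 * n ^ (n + 1) ≤ (n + 1) ^ (n + 1) := by
  have h := pow_add_mul_le_add_pow (Nat.zero_le n) (b := 1) (by positivity) (n + 1)
  simp only [Nat.add_sub_cancel, mul_one, Nat.cast_id] at h
  nlinarith [pow_succ n n, Nat.zero_le (n ^ n)]

/-- Adjacency in the cycle of length five. -/
def cycleAdj (i j : Fin 5) : Bool := decide (i + 1 = j ∨ j + 1 = i)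

/-- Five points of a sequence, one from each fifth, indexed by lines `y = a + b x`; two different
lines share at most one point. -/
def linePoint {α : Type*} {q : ℕ} (w : Fin (5 * (5 * q)) → α) (l : Fin q × Fin q) (i : Fin 5) : α :=
  w ⟨i * (5 * q) + (l.1 + i * l.2), by
    obtain ⟨⟨a, ha⟩, ⟨b, hb⟩⟩ := l
    fin_cases i <;> simp <;> omega⟩

lemma linePoint_strictMono {N q : ℕ} {w : Fin (5 * (5 * q)) → Fin N} (hw : StrictMono w)
    (l : Fin q × Fin q) : StrictMono (linePoint w l) := by
  intro i j hij
  refine hw ?_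
  obtain ⟨⟨a, ha⟩, ⟨b, hb⟩⟩ := l
  simp only [Fin.mk_lt_mk]
  fin_cases i <;> fin_cases j <;> simp at hij ⊢ <;> omega

lemma linePoint_eq_imp {N q : ℕ} {w : Fin (5 * (5 * q)) → Fin N} (hw : StrictMono w)
    {l l' : Fin q × Fin q} {i i' : Fin 5} (h : linePoint w l i = linePoint w l' i') :
    i = i' ∧ (l.1 + i * l.2 : ℕ) = l'.1 + i' * l'.2 := by
  have h := Fin.mk.inj_iff.1 (hw.injective h)
  obtain ⟨⟨a, ha⟩, ⟨b, hb⟩⟩ := l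
  obtain ⟨⟨a', ha'⟩, ⟨b', hb'⟩⟩ := l'
  fin_cases i <;> fin_cases i' <;> simp at h ⊢ <;> omega

/-- The pairs spanned by the points on a line. -/
def linePairs {N q : ℕ} (w : Fin (5 * (5 * q)) → Fin N) (l : Fin q × Fin q) :
    Finset (Fin N × Fin N) :=
  (Finset.univ.filter fun p : Fin 5 × Fin 5 => p.1 < p.2).image
    fun p => (linePoint w l p.1, linePoint w l p.2)

lemma card_linePairs_le {N q : ℕ} (w : Fin (5 * (5 * q)) → Fin N) (l : Fin q × Fin q) :
    (linePairs w l).card ≤ 10 :=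
  Finset.card_image_le.trans (by decide)

lemma disjoint_linePairs {N q : ℕ} {w : Fin (5 * (5 * q)) → Fin N} (hw : StrictMono w)
    {l l' : Fin q × Fin q} (h : l ≠ l') : Disjoint (linePairs w l) (linePairs w l') := by
  refine Finset.disjoint_left.2 fun x hx hx' => h ?_
  obtain ⟨⟨i, j⟩, hij, rfl⟩ := Finset.mem_image.1 hx
  obtain ⟨⟨i', j'⟩, hij', he⟩ := Finset.mem_image.1 hx'
  obtain ⟨rfl, h1⟩ := linePoint_eq_imp hw (Prod.ext_iff.1 he).1
  obtain ⟨rfl, h2⟩ := linePoint_eq_imp hw (Prod.ext_iff.1 he).2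
  simp only [Finset.mem_filter, Finset.mem_univ, true_and] at hij
  obtain ⟨⟨a, ha⟩, ⟨b, hb⟩⟩ := l
  obtain ⟨⟨a', ha'⟩, ⟨b', hb'⟩⟩ := l'
  simp only [Prod.mk.injEq, Fin.mk.injEq]
  revert h1 h2 hij
  clear hx hx' hij' he h
  fin_cases i' <;> fin_cases j' <;> simp <;> omega

/-- The colours that make the points on a line span a cycle of length five. -/
def linePattern {N q : ℕ} (w : Fin (5 * (5 * q)) → Fin N) (l : Fin q × Fin q)
    (x : Fin N × Fin N) : Bool :=
  decide (∃ i j, cycleAdj i j = true ∧ x = (linePoint w l i, linePoint w l j))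

lemma linePattern_linePoint {N q : ℕ} {w : Fin (5 * (5 * q)) → Fin N} (hw : StrictMono w)
    (l : Fin q × Fin q) (i j : Fin 5) :
    linePattern w l (linePoint w l i, linePoint w l j) = cycleAdj i j := by
  have hinj := (linePoint_strictMono hw l).injective
  simp [linePattern, hinj.eq_iff]

/-- Some two-colouring of the pairs induces a five-cycle on some line of every sequence. -/
lemma exists_coloring {m : ℕ} (hm : 1 ≤ m) :
    ∃ ω : Fin (2 ^ m) × Fin (2 ^ m) → Bool,
      ∀ w : Fin (5 * (5 * (1024 * 26 * m))) → Fin (2 ^ m), StrictMono w →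
        ∃ l, ∀ i j, i < j → ω (linePoint w l i, linePoint w l j) = cycleAdj i j := by
  classical
  obtain ⟨q, hq⟩ : ∃ q, q = 1024 * 26 * m := ⟨_, rfl⟩
  rw [← hq]
  by_contra! hcon
  set P := Fin (2 ^ m) × Fin (2 ^ m)
  set S := Finset.univ.filter fun w : Fin (5 * (5 * q)) → Fin (2 ^ m) => StrictMono w with hS
  set bad : (Fin (5 * (5 * q)) → Fin (2 ^ m)) → Finset (P → Bool) := fun w =>
    Finset.univ.filter fun ω => ∀ l ∈ (Finset.univ : Finset (Fin q × Fin q)),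
      ∃ x ∈ linePairs w l, ω x ≠ linePattern w l x with hbad
  have hcover : (Finset.univ : Finset (P → Bool)) ⊆ S.biUnion bad := by
    intro ω _
    obtain ⟨w, hw, h⟩ := hcon ω
    refine Finset.mem_biUnion.2 ⟨w, by simpa [hS] using hw, ?_⟩
    refine Finset.mem_filter.2 ⟨Finset.mem_univ _, fun l _ => ?_⟩
    obtain ⟨i, j, hij, hne⟩ := h l
    refine ⟨_, Finset.mem_image.2 ⟨(i, j), by simpa using hij, rfl⟩, ?_⟩
    rwa [linePattern_linePoint hw]
  have hb : ∀ w ∈ S, (2 ^ 10) ^ (q * q) * (bad w).card ≤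
      (2 ^ 10 - 1) ^ (q * q) * 2 ^ Fintype.card P := by
    intro w hw
    have hw : StrictMono w := by simpa [hS] using hw
    have := card_avoiding_mul_le (d := 10) (Finset.univ : Finset (Fin q × Fin q)) (linePairs w)
      (linePattern w) (fun _ _ _ _ h => disjoint_linePairs hw h) (fun l _ => card_linePairs_le w l)
    have hc : (Finset.univ : Finset (Fin q × Fin q)).card = q * q := by simp
    rw [hc] at this
    convert this
  have hSc : S.card ≤ (2 ^ m) ^ (5 * (5 * q)) := by
    refine (Finset.card_le_univ _).trans ?_
    simp
  have hle : (2 ^ 10) ^ (q * q) * 2 ^ Fintype.card P ≤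
      (2 ^ m) ^ (5 * (5 * q)) * ((2 ^ 10 - 1) ^ (q * q) * 2 ^ Fintype.card P) := by
    calc (2 ^ 10) ^ (q * q) * 2 ^ Fintype.card P
        = (2 ^ 10) ^ (q * q) * (Finset.univ : Finset (P → Bool)).card := by simp
      _ ≤ (2 ^ 10) ^ (q * q) * ∑ w ∈ S, (bad w).card :=
          Nat.mul_le_mul_left _ ((Finset.card_le_card hcover).trans Finset.card_biUnion_le)
      _ = ∑ w ∈ S, (2 ^ 10) ^ (q * q) * (bad w).card := Finset.mul_sum _ _ _
      _ ≤ S.card * ((2 ^ 10 - 1) ^ (q * q) * 2 ^ Fintype.card P) :=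
          Finset.sum_le_card_nsmul _ _ _ hb
      _ ≤ _ := Nat.mul_le_mul_right _ hSc
  rw [← mul_assoc] at hle
  have hle := Nat.le_of_mul_le_mul_right hle (by positivity)
  have hqq : q * q = (1023 + 1) * (26 * m * q) := by
    nth_rewrite 1 [hq]
    ring
  have hD : 2 ^ 10 - 1 = 1023 := rfl
  have hD' : 2 ^ 10 = 1023 + 1 := rfl
  rw [hD, hD'] at hle
  have h1 := Nat.pow_le_pow_left (two_mul_pow_le 1023) (26 * m * q)
  rw [mul_pow, ← pow_mul, ← pow_mul, ← hqq] at h1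
  have h2 := Nat.le_of_mul_le_mul_right (h1.trans hle) (by positivity)
  rw [← pow_mul] at h2
  have h3 := (Nat.pow_le_pow_iff_right (by norm_num)).1 h2
  have hmq : 0 < m * q := Nat.mul_pos hm (by omega)
  nlinarith

/-- The 4-graph of vertex sets without monochromatic triangles. -/
def triEdge (G : ℕ → ℕ → Bool) (e : Finset ℕ) : Prop :=
  ∀ x ∈ e, ∀ y ∈ e, ∀ z ∈ e, x ≠ y → x ≠ z → y ≠ z → ¬ (G x y = G x z ∧ G x y = G y z)

/-- Monochromatic links. -/
def constLink (G : ℕ → ℕ → Bool) (r : ℕ) (B : Finset ℕ) : Prop :=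
  ∀ b ∈ B, ∀ b' ∈ B, G r b = G r b'

lemma exists_constant_subset (g : ℕ → Bool) {B : Finset ℕ} {t : ℕ} (h : 2 * t + 1 ≤ B.card) :
    ∃ β, ∃ B' ⊆ B, B'.card = t + 1 ∧ ∀ b ∈ B', g b = β := by
  obtain ⟨β, _, hβ⟩ := Finset.exists_lt_card_fiber_of_mul_lt_card_of_maps_to (s := B)
    (t := Finset.univ) (f := g) (n := t) (fun _ _ => Finset.mem_univ _) (by simp; omega)
  obtain ⟨B', hB', hc⟩ := Finset.exists_subset_card_eq (Nat.succ_le_of_lt hβ)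
  exact ⟨β, B', hB'.trans (Finset.filter_subset _ _), hc, fun b hb =>
    (Finset.mem_filter.1 (hB' hb)).2⟩

lemma eq_and_eq_of_ne {β p q r : Bool} (hp : β ≠ p) (hq : β ≠ q) (hr : β ≠ r) :
    p = q ∧ p = r := by
  revert β p q r
  decide

lemma not_triEdge_of_card_six {G : ℕ → ℕ → Bool} {T : Finset ℕ}
    (hT : T.card = 6) : ¬ triEdge G T := by
  intro h
  obtain ⟨v, hv⟩ : T.Nonempty := Finset.card_pos.1 (by omega)
  obtain ⟨β, B, hB, hc, hβ⟩ := exists_constant_subset (G v) (B := T.erase v) (t := 2)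
    (by rw [Finset.card_erase_of_mem hv]; omega)
  obtain ⟨x, y, z, hxy, hxz, hyz, rfl⟩ := Finset.card_eq_three.1 hc
  simp only [Finset.insert_subset_iff, Finset.singleton_subset_iff, Finset.mem_erase] at hB
  simp only [Finset.mem_insert, Finset.mem_singleton, forall_eq_or_imp, forall_eq] at hβ
  obtain ⟨⟨hvx, hx⟩, ⟨hvy, hy⟩, ⟨hvz, hz⟩⟩ := hB
  obtain ⟨bx, bY, bz⟩ := hβ
  have h1 := h v hv x hx y hy hvx.symm hvy.symm hxy
  have h2 := h v hv x hx z hz hvx.symm hvz.symm hxz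
  have h3 := h v hv y hy z hz hvy.symm hvz.symm hyz
  refine h x hx y hy z hz hxy hxz hyz (eq_and_eq_of_ne (β := β) ?_ ?_ ?_)
  · exact fun h => h1 ⟨bx.trans bY.symm, bx.trans h⟩
  · exact fun h => h2 ⟨bx.trans bz.symm, bx.trans h⟩
  · exact fun h => h3 ⟨bY.trans bz.symm, bY.trans h⟩

lemma isGood_four {m : ℕ} (hm : 1 ≤ m) :
    ∃ E F, IsGood 4 3 (25 * (1024 * 26) * m) (2 ^ m) E F := by
  obtain ⟨ω, hω⟩ := exists_coloring hm
  have : NeZero (2 ^ m) := ⟨by positivity⟩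
  set G : ℕ → ℕ → Bool := fun x y =>
    ω (Fin.ofNat (2 ^ m) (min x y), Fin.ofNat (2 ^ m) (max x y)) with hGdef
  have hG : ∀ x y, G x y = G y x := fun x y => by simp only [hGdef, min_comm, max_comm]
  refine ⟨triEdge G, constLink G, ?_, ?_, ?_, ?_⟩
  · intro T _ hT
    have hn := not_triEdge_of_card_six (G := G) hT
    simp only [triEdge, not_forall, not_not] at hn
    obtain ⟨x, hx, y, hy, z, hz, hxy, hxz, hyz, hmono⟩ := hn
    obtain ⟨e, hxe, heT, he⟩ := Finset.exists_subsuperset_card_eq (s := {x, y, z}) (t := T) (n := 4)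
      (by simp [Finset.insert_subset_iff, hx, hy, hz])
      (Finset.card_le_three.trans (by norm_num)) (by omega)
    exact ⟨e, heT, he, fun h => h x (hxe (by simp)) y (hxe (by simp)) z (hxe (by simp))
      hxy hxz hyz hmono⟩
  · intro W hW hn
    obtain ⟨W', hW', hc⟩ := Finset.exists_subset_card_eq
      (show 5 * (5 * (1024 * 26 * m)) ≤ W.card by omega)
    have hlt : ∀ i, W'.orderEmbOfFin hc i < 2 ^ m := fun i =>
      Finset.mem_range.1 (hW (hW' (Finset.orderEmbOfFin_mem _ _ _)))
    obtain ⟨l, hl⟩ := hω (fun i => ⟨W'.orderEmbOfFin hc i, hlt i⟩)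
      (fun i j hij => by simpa using hij)
    set p : Fin 5 → ℕ := linePoint (W'.orderEmbOfFin hc) l with hp
    have hmono : StrictMono p := linePoint_strictMono (w := fun i => ⟨W'.orderEmbOfFin hc i, hlt i⟩)
      (fun i j hij => by simpa using hij) l
    have hval : ∀ i j, i < j → G (p i) (p j) = cycleAdj i j := by
      intro i j hij
      rw [← hl i j hij]
      have h1 : ∀ i, Fin.ofNat (2 ^ m) (p i) =
          linePoint (fun i => (⟨W'.orderEmbOfFin hc i, hlt i⟩ : Fin (2 ^ m))) l i :=
        fun i => Fin.ext (Nat.mod_eq_of_lt (hlt _))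
      simp only [hGdef, min_eq_left (hmono hij).le, max_eq_right (hmono hij).le, h1]
    have hval' : ∀ i j, i ≠ j → G (p i) (p j) = cycleAdj i j := by
      intro i j hij
      rcases lt_or_gt_of_ne hij with h | h
      · exact hval i j h
      · rw [hG, hval j i h]
        revert i j
        decide
    refine ⟨Finset.univ.image p, ?_, ?_, ?_⟩
    · intro x hx
      obtain ⟨i, _, rfl⟩ := Finset.mem_image.1 hx
      exact hW' (Finset.orderEmbOfFin_mem _ _ _)
    · rw [Finset.card_image_of_injective _ hmono.injective]
      rfl
    · intro e he _ x hx y hy z hz hxy hxz hyz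
      obtain ⟨i, _, rfl⟩ := Finset.mem_image.1 (he hx)
      obtain ⟨j, _, rfl⟩ := Finset.mem_image.1 (he hy)
      obtain ⟨t, _, rfl⟩ := Finset.mem_image.1 (he hz)
      have hij : i ≠ j := fun h => hxy (h ▸ rfl)
      have hit : i ≠ t := fun h => hxz (h ▸ rfl)
      have hjt : j ≠ t := fun h => hyz (h ▸ rfl)
      rw [hval' i j hij, hval' i t hit, hval' j t hjt]
      clear * - hij hit hjt
      revert i j t
      decide
  · intro e _ he hE r hr
    by_contra! hcon
    have hc : (e.erase r).card = 3 := by rw [Finset.card_erase_of_mem hr, he]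
    have hcl : ∀ x ∈ e.erase r, ∀ y ∈ e.erase r, x ≠ y → G r x = G r y := by
      intro x hx y hy hxy
      exact hcon {x, y} (by simp [Finset.insert_subset_iff, Finset.mem_erase.1 hx,
        Finset.mem_erase.1 hy]) (Finset.card_pair hxy) x (by simp) y (by simp)
    obtain ⟨x, y, z, hxy, hxz, hyz, hs⟩ := Finset.card_eq_three.1 hc
    have hx : x ∈ e.erase r := by simp [hs]
    have hy : y ∈ e.erase r := by simp [hs]
    have hz : z ∈ e.erase r := by simp [hs]
    have b1 := hcl x hx y hy hxy
    have b2 := hcl x hx z hz hxz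
    rw [Finset.mem_erase] at hx hy hz
    have h1 := hE r hr x hx.2 y hy.2 hx.1.symm hy.1.symm hxy
    have h2 := hE r hr x hx.2 z hz.2 hx.1.symm hz.1.symm hxz
    have h3 := hE r hr y hy.2 z hz.2 hy.1.symm hz.1.symm hyz
    refine hE x hx.2 y hy.2 z hz.2 hxy hxz hyz (eq_and_eq_of_ne (β := G r x) ?_ ?_ ?_)
    · exact fun h => h1 ⟨b1, h⟩
    · exact fun h => h2 ⟨b2, h⟩
    · exact fun h => h3 ⟨b1.symm.trans b2, b1.symm.trans h⟩
  · intro r _ B _ _ hB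
    obtain ⟨β, B', hB', hc, hβ⟩ := exists_constant_subset (G r) (t := 1) hB
    exact ⟨B', hB', hc, fun b hb b' hb' => (hβ b hb).trans (hβ b' hb').symm⟩

lemma IsGood.mono {k c n n' M : ℕ} {E : Finset ℕ → Prop} {F : ℕ → Finset ℕ → Prop}
    (hG : IsGood k c n M E F) (hn : n ≤ n') : IsGood k c n' M E F :=
  ⟨hG.cliqueFree, fun W hW h => hG.exists_clique W hW (hn.trans h), hG.exists_not_link,
    hG.exists_link⟩

lemma exists_isGood_tower (i : ℕ) : ∃ c K : ℕ, 1 ≤ K ∧ ∀ m, 1 ≤ m →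
    ∃ E F, IsGood (i + 4) c (K * m) ((fun x => 2 ^ x)^[i + 1] m) E F := by
  induction i with
  | zero => exact ⟨3, 25 * (1024 * 26), by norm_num, fun m hm => isGood_four hm⟩
  | succ i ih =>
    obtain ⟨c, K, hK, h⟩ := ih
    refine ⟨(c + 1) * 2 ^ c, (2 ^ c + 3) * (2 * K), Nat.mul_pos (by positivity) (by omega),
      fun m hm => ?_⟩
    obtain ⟨E, F, hG⟩ := h m hm
    refine ⟨stepEdge (i + 4) E F, stepLink F, ?_⟩
    rw [Function.iterate_succ_apply']
    refine (hG.step (by omega)).mono ?_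
    rw [mul_assoc]
    refine Nat.mul_le_mul_left _ ?_
    nlinarith [Nat.mul_pos hK hm]

lemma IsGood.erdosRogersG_le {k c n M N : ℕ} {E : Finset ℕ → Prop} {F : ℕ → Finset ℕ → Prop}
    (hG : IsGood k c n M E F) (hN : N ≤ M) : erdosRogersG k N ≤ n := by
  have hr : Finset.range N ⊆ Finset.range M := Finset.range_subset_range.2 hN
  refine le_trans (Nat.sInf_le (Set.mem_ofPred.2 ⟨E, ?_, rfl⟩)) ?_
  · rintro ⟨S, hS, hc, h⟩
    obtain ⟨e, he, hk, hE⟩ := hG.cliqueFree S (hS.trans hr) hc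
    exact hE (h e he hk)
  · refine csSup_le' ?_
    rintro _ ⟨W, hW, rfl, h⟩
    by_contra! hlt
    exact h (hG.exists_clique W (hW.trans hr) hlt.le)

lemma tendsto_iterLog (i : ℕ) : Filter.Tendsto (iterLog i) Filter.atTop Filter.atTop := by
  induction i with
  | zero => exact Filter.tendsto_id
  | succ i ih =>
    have h : iterLog (i + 1) = Real.logb 2 ∘ iterLog i :=
      funext fun x => Function.iterate_succ_apply' _ _ _
    rw [h]
    exact (Real.tendsto_logb_atTop one_lt_two).comp ih

lemma le_iterate_two_pow {i m : ℕ} {x : ℝ} (hpos : ∀ j < i, 0 < iterLog j x)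
    (hm : iterLog i x ≤ m) : x ≤ ((fun y : ℕ => 2 ^ y)^[i] m : ℕ) := by
  induction i generalizing m with
  | zero => exact hm
  | succ i ih =>
    rw [Function.iterate_succ_apply]
    refine ih (fun j hj => hpos j (by omega)) ?_
    have h : iterLog (i + 1) x = Real.logb 2 (iterLog i x) := Function.iterate_succ_apply' _ _ _
    rw [h, Real.logb_le_iff_le_rpow one_lt_two (hpos i (by omega)), Real.rpow_natCast] at hm
    exact_mod_cast hm

/-- For each fixed `k ≥ 5` there is a constant `C > 0` such that for all sufficiently large `N`,
`g(k,N) ≤ C · log_{(k-3)} N`, where `log_{(i)}` is the base-2 logarithm iterated `i` times. -/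
theorem stmt3 : ∀ k : ℕ, 5 ≤ k → ∃ C : ℝ, 0 < C ∧ ∃ N0 : ℕ, ∀ N : ℕ, N0 ≤ N →
    (erdosRogersG k N : ℝ) ≤ C * iterLog (k - 3) (N : ℝ) := by
  intro k hk
  obtain ⟨i, rfl⟩ := Nat.exists_eq_add_of_le' (show 4 ≤ k by omega)
  obtain ⟨c, K, hK, h⟩ := exists_isGood_tower i
  have hlarge : ∀ᶠ N : ℕ in Filter.atTop, ∀ j ∈ Finset.range (i + 2), 1 ≤ iterLog j (N : ℝ) :=
    (Filter.eventually_all_finset _).2 fun j _ =>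
      ((tendsto_iterLog j).comp tendsto_natCast_atTop_atTop).eventually_ge_atTop 1
  obtain ⟨N0, hN0⟩ := Filter.eventually_atTop.1 hlarge
  have hKpos : (0 : ℝ) < K := by exact_mod_cast hK
  refine ⟨2 * K, by positivity, N0, fun N hN => ?_⟩
  have hge := hN0 N hN
  rw [show i + 4 - 3 = i + 1 by omega]
  set x := iterLog (i + 1) (N : ℝ) with hx
  have hx1 : 1 ≤ x := hge _ (by simp)
  obtain ⟨E, F, hG⟩ := h ⌈x⌉₊ (Nat.ceil_pos.2 (by linarith))
  have hNM : N ≤ (fun y : ℕ => 2 ^ y)^[i + 1] ⌈x⌉₊ := by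
    have := le_iterate_two_pow (i := i + 1) (x := (N : ℝ)) (fun j hj =>
      lt_of_lt_of_le one_pos (hge j (Finset.mem_range.2 (by omega)))) (Nat.le_ceil x)
    exact_mod_cast this
  have hle : (erdosRogersG (i + 4) N : ℝ) ≤ K * ⌈x⌉₊ := by exact_mod_cast hG.erdosRogersG_le hNM
  have hceil := (Nat.ceil_lt_add_one (show 0 ≤ x by linarith)).le
  nlinarith
end

section
/- For each fixed integer k ≥ 6 and every positive integer N, g(k, 2^N) < (k+2) · g(k−1, N). -/
/-- The position of the highest binary digit in which `a` and `b` differ. -/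
noncomputable def splitLevel (a b : ℕ) : ℕ :=
  sInf {j | a / 2 ^ (j + 1) = b / 2 ^ (j + 1)}

lemma splitLevel_comm (a b : ℕ) : splitLevel a b = splitLevel b a := by
  simp only [splitLevel, eq_comm]

lemma splitLevel_le_iff (a b j : ℕ) :
    splitLevel a b ≤ j ↔ a / 2 ^ (j + 1) = b / 2 ^ (j + 1) := by
  constructor
  · intro h
    have hne : {j | a / 2 ^ (j + 1) = b / 2 ^ (j + 1)}.Nonempty := by
      refine ⟨a + b, ?_⟩
      have h1 : a + b < 2 ^ (a + b) := Nat.lt_two_pow_self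
      have h2 : 2 ^ (a + b) ≤ 2 ^ (a + b + 1) := Nat.pow_le_pow_right (by norm_num) (by omega)
      show a / 2 ^ (a + b + 1) = b / 2 ^ (a + b + 1)
      rw [Nat.div_eq_of_lt (by omega), Nat.div_eq_of_lt (by omega)]
    have hm : a / 2 ^ (splitLevel a b + 1) = b / 2 ^ (splitLevel a b + 1) := Nat.sInf_mem hne
    obtain ⟨c, rfl⟩ := Nat.exists_eq_add_of_le h
    rw [show splitLevel a b + c + 1 = splitLevel a b + 1 + c by ring, pow_add,
      ← Nat.div_div_eq_div_mul, ← Nat.div_div_eq_div_mul, hm]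
  · intro h
    exact Nat.sInf_le h

lemma splitLevel_lt {a b N : ℕ} (hN : 1 ≤ N) (ha : a < 2 ^ N) (hb : b < 2 ^ N) :
    splitLevel a b < N := by
  have : splitLevel a b ≤ N - 1 := by
    rw [splitLevel_le_iff, Nat.sub_add_cancel hN, Nat.div_eq_of_lt ha, Nat.div_eq_of_lt hb]
  omega

lemma splitLevel_eq_max {a b c : ℕ} (hab : a < b) (hbc : b < c) :
    splitLevel a c = max (splitLevel a b) (splitLevel b c) := by
  refine eq_of_forall_ge_iff fun j => ?_
  rw [max_le_iff, splitLevel_le_iff, splitLevel_le_iff, splitLevel_le_iff]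
  have h1 : a / 2 ^ (j + 1) ≤ b / 2 ^ (j + 1) := Nat.div_le_div_right hab.le
  have h2 : b / 2 ^ (j + 1) ≤ c / 2 ^ (j + 1) := Nat.div_le_div_right hbc.le
  omega

lemma splitLevel_ne {a b c : ℕ} (hab : a < b) (hbc : b < c) :
    splitLevel a b ≠ splitLevel b c := by
  intro h
  have h1 := (splitLevel_le_iff a b _).1 le_rfl
  have h2 := (splitLevel_le_iff b c _).1 le_rfl
  rw [← h] at h2
  rcases hj : splitLevel a b with _ | j
  · rw [hj] at h1 h2
    norm_num at h1 h2
    omega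
  · have h3 := mt (splitLevel_le_iff a b j).2 (by omega)
    have h4 := mt (splitLevel_le_iff b c j).2 (by omega)
    rw [hj, pow_succ, ← Nat.div_div_eq_div_mul, ← Nat.div_div_eq_div_mul] at h1 h2
    have h5 : a / 2 ^ (j + 1) ≤ b / 2 ^ (j + 1) := Nat.div_le_div_right hab.le
    have h6 : b / 2 ^ (j + 1) ≤ c / 2 ^ (j + 1) := Nat.div_le_div_right hbc.le
    omega

/-- Along `A`, read in the direction of `r`, the split levels are strictly decreasing. -/
def LevelDecreasing (r : ℕ → ℕ → Prop) (A : Finset ℕ) : Prop :=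
  ∀ x ∈ A, ∀ y ∈ A, ∀ z ∈ A, r x y → r y z → splitLevel y z < splitLevel x y

lemma LevelDecreasing.mono {r : ℕ → ℕ → Prop} {A B : Finset ℕ} (h : LevelDecreasing r A)
    (hBA : B ⊆ A) : LevelDecreasing r B :=
  fun x hx y hy z hz => h x (hBA hx) y (hBA hy) z (hBA hz)

/-- The set of split levels of pairs of distinct elements of `e`. -/
noncomputable def levels (e : Finset ℕ) : Finset ℕ :=
  e.offDiag.image fun p => splitLevel p.1 p.2

lemma levels_mono {e f : Finset ℕ} (h : e ⊆ f) : levels e ⊆ levels f :=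
  Finset.image_subset_image (Finset.offDiag_mono h)

lemma levels_subset_range {A : Finset ℕ} {N : ℕ} (hN : 1 ≤ N) (hA : A ⊆ Finset.range (2 ^ N)) :
    levels A ⊆ Finset.range N := by
  intro t ht
  simp only [levels, Finset.mem_image, Finset.mem_offDiag, Prod.exists] at ht
  obtain ⟨a, b, ⟨ha, hb, -⟩, rfl⟩ := ht
  exact Finset.mem_range.2
    (splitLevel_lt hN (Finset.mem_range.1 (hA ha)) (Finset.mem_range.1 (hA hb)))

lemma exists_last {r : ℕ → ℕ → Prop} (hr : r = (· < ·) ∨ r = (· > ·))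
    {A : Finset ℕ} (hA : A.Nonempty) : ∃ p ∈ A, ∀ x ∈ A, x ≠ p → r x p := by
  rcases hr with rfl | rfl
  · exact ⟨A.max' hA, A.max'_mem hA, fun x hx hne => lt_of_le_of_ne (A.le_max' x hx) hne⟩
  · exact ⟨A.min' hA, A.min'_mem hA, fun x hx hne => lt_of_le_of_ne (A.min'_le x hx) hne.symm⟩

lemma splitLevel_eq_max_of_rel {r : ℕ → ℕ → Prop} (hr : r = (· < ·) ∨ r = (· > ·))
    {a b c : ℕ} (hab : r a b) (hbc : r b c) :
    splitLevel a c = max (splitLevel a b) (splitLevel b c) := by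
  rcases hr with rfl | rfl
  · exact splitLevel_eq_max hab hbc
  · rw [splitLevel_comm a c, splitLevel_comm a b, splitLevel_comm b c, max_comm]
    exact splitLevel_eq_max hbc hab

lemma rel_total {r : ℕ → ℕ → Prop} (hr : r = (· < ·) ∨ r = (· > ·))
    {a b : ℕ} (h : a ≠ b) : r a b ∨ r b a := by
  rcases hr with rfl | rfl
  · exact lt_or_gt_of_ne h
  · exact (lt_or_gt_of_ne h).symm

lemma LevelDecreasing.splitLevel_eq {r : ℕ → ℕ → Prop} (hr : r = (· < ·) ∨ r = (· > ·))
    {A : Finset ℕ} (h : LevelDecreasing r A) {p : ℕ} (hp : p ∈ A)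
    (hlast : ∀ x ∈ A, x ≠ p → r x p) {x y : ℕ} (hx : x ∈ A) (hy : y ∈ A) (hxy : r x y) :
    splitLevel x y = splitLevel x p := by
  by_cases hyp : y = p
  · rw [hyp]
  · have hyp' := hlast y hy hyp
    have := h x hx y hy p hp hxy hyp'
    rw [splitLevel_eq_max_of_rel hr hxy hyp']
    omega

lemma LevelDecreasing.levels_eq {r : ℕ → ℕ → Prop} (hr : r = (· < ·) ∨ r = (· > ·))
    {A : Finset ℕ} (h : LevelDecreasing r A) {p : ℕ} (hp : p ∈ A)
    (hlast : ∀ x ∈ A, x ≠ p → r x p) :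
    levels A = (A.erase p).image (splitLevel · p) := by
  ext t
  simp only [levels, Finset.mem_image, Finset.mem_offDiag, Prod.exists, Finset.mem_erase]
  constructor
  · rintro ⟨a, b, ⟨ha, hb, hab⟩, rfl⟩
    have key : ∀ a ∈ A, ∀ b ∈ A, a ≠ b → r a b →
        ∃ x, (x ≠ p ∧ x ∈ A) ∧ splitLevel x p = splitLevel a b := by
      intro a ha b hb hab hrab
      refine ⟨a, ⟨?_, ha⟩, (h.splitLevel_eq hr hp hlast ha hb hrab).symm⟩
      rintro rfl
      have := hlast b hb hab.symm
      rcases hr with rfl | rfl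
      · exact lt_asymm hrab this
      · exact lt_asymm hrab this
    rcases rel_total hr hab with hrab | hrab
    · exact key a ha b hb hab hrab
    · rw [splitLevel_comm a b]
      exact key b hb a ha hab.symm hrab
  · rintro ⟨x, ⟨hne, hx⟩, rfl⟩
    exact ⟨x, p, ⟨hx, hp, hne⟩, rfl⟩

lemma LevelDecreasing.injOn {r : ℕ → ℕ → Prop} (hr : r = (· < ·) ∨ r = (· > ·))
    {A : Finset ℕ} (h : LevelDecreasing r A) {p : ℕ} (hp : p ∈ A)
    (hlast : ∀ x ∈ A, x ≠ p → r x p) :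
    Set.InjOn (splitLevel · p) (A.erase p : Set ℕ) := by
  have key : ∀ x ∈ A, ∀ y ∈ A, y ≠ p → r x y → splitLevel x p ≠ splitLevel y p := by
    intro x hx y hy hyp hxy
    rw [← h.splitLevel_eq hr hp hlast hx hy hxy]
    exact (h x hx y hy p hp hxy (hlast y hy hyp)).ne'
  intro x hx y hy hxy
  by_contra hne
  simp only [Finset.coe_erase, Set.mem_sdiff, Finset.mem_coe, Set.mem_singleton_iff] at hx hy
  rcases rel_total hr hne with h1 | h1
  · exact key x hx.1 y hy.1 hy.2 h1 hxy
  · exact key y hy.1 x hx.1 hx.2 h1 hxy.symm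

lemma LevelDecreasing.card_levels {r : ℕ → ℕ → Prop} (hr : r = (· < ·) ∨ r = (· > ·))
    {A : Finset ℕ} (h : LevelDecreasing r A) :
    (levels A).card = A.card - 1 := by
  rcases A.eq_empty_or_nonempty with rfl | hA
  · simp [levels]
  obtain ⟨p, hp, hlast⟩ := exists_last hr hA
  rw [h.levels_eq hr hp hlast, Finset.card_image_of_injOn (h.injOn hr hp hlast),
    Finset.card_erase_of_mem hp]

lemma LevelDecreasing.exists_levels_eq {r : ℕ → ℕ → Prop} (hr : r = (· < ·) ∨ r = (· > ·))
    {A K : Finset ℕ} (h : LevelDecreasing r A)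
    (hA : A.Nonempty) (hK : K ⊆ levels A) :
    ∃ S ⊆ A, levels S = K ∧ S.card = K.card + 1 := by
  obtain ⟨p, hp, hlast⟩ := exists_last hr hA
  have hinj := h.injOn hr hp hlast
  rw [h.levels_eq hr hp hlast] at hK
  set B := (A.erase p).filter (splitLevel · p ∈ K) with hB
  have hBA : B ⊆ A.erase p := Finset.filter_subset _ _
  have hpB : p ∉ B := fun hmem => Finset.notMem_erase p A (hBA hmem)
  have hSA : insert p B ⊆ A :=
    Finset.insert_subset hp (hBA.trans (Finset.erase_subset _ _))
  have himg : B.image (splitLevel · p) = K := by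
    ext t
    simp only [Finset.mem_image, hB, Finset.mem_filter]
    constructor
    · rintro ⟨x, ⟨-, hx⟩, rfl⟩
      exact hx
    · intro ht
      obtain ⟨x, hx, rfl⟩ := Finset.mem_image.1 (hK ht)
      exact ⟨x, ⟨hx, ht⟩, rfl⟩
  refine ⟨insert p B, hSA, ?_, ?_⟩
  · rw [(h.mono hSA).levels_eq hr (Finset.mem_insert_self p B) fun x hx => hlast x (hSA hx),
      Finset.erase_insert hpB, himg]
  · rw [Finset.card_insert_of_notMem hpB, ← himg,
      Finset.card_image_of_injOn (hinj.mono (by exact_mod_cast hBA))]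

lemma levelDecreasing_lt_image {v : ℕ → ℕ} {n : ℕ} (hv : ∀ i j, i < j → j < n → v i < v j)
    (h : ∀ i, i + 2 < n →
      splitLevel (v (i + 1)) (v (i + 2)) < splitLevel (v i) (v (i + 1))) :
    LevelDecreasing (· < ·) ((Finset.range n).image v) := by
  have anti : ∀ i j, i < j → j + 1 < n →
      splitLevel (v j) (v (j + 1)) < splitLevel (v i) (v (i + 1)) := by
    intro i j hij
    induction j, hij using Nat.le_induction with
    | base => exact fun hn => h i hn
    | succ j hij ih => exact fun hn => (h j hn).trans (ih (by omega))
  have first : ∀ i j, i < j → j < n → splitLevel (v i) (v j) = splitLevel (v i) (v (i + 1)) := by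
    intro i j hij
    induction j, hij using Nat.le_induction with
    | base => exact fun _ => rfl
    | succ j hij ih =>
      intro hn
      rw [splitLevel_eq_max (hv i j hij (by omega)) (hv j (j + 1) (by omega) hn),
        ih (by omega), max_eq_left (anti i j hij hn).le]
  have lt_of : ∀ i j, i < n → v i < v j → i < j := by
    intro i j hi hij
    by_contra hc
    rcases (not_lt.1 hc).eq_or_lt with rfl | hlt
    · exact lt_irrefl _ hij
    · exact lt_asymm hij (hv j i hlt hi)
  intro x hx y hy z hz hxy hyz
  simp only [Finset.mem_image, Finset.mem_range] at hx hy hz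
  obtain ⟨i, hi, rfl⟩ := hx
  obtain ⟨j, hj, rfl⟩ := hy
  obtain ⟨l, hl, rfl⟩ := hz
  have hij := lt_of i j hi hxy
  have hjl := lt_of j l hj hyz
  rw [first i j hij hj, first j l hjl hl]
  exact anti i j hij (by omega)

lemma levelDecreasing_gt_image {v : ℕ → ℕ} {n : ℕ} (hv : ∀ i j, i < j → j < n → v i < v j)
    (h : ∀ i, i + 2 < n →
      splitLevel (v i) (v (i + 1)) < splitLevel (v (i + 1)) (v (i + 2))) :
    LevelDecreasing (· > ·) ((Finset.range n).image v) := by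
  have mono : ∀ i j, i < j → j + 1 < n →
      splitLevel (v i) (v (i + 1)) < splitLevel (v j) (v (j + 1)) := by
    intro i j hij
    induction j, hij using Nat.le_induction with
    | base => exact fun hn => h i hn
    | succ j hij ih => exact fun hn => (ih (by omega)).trans (h j hn)
  have last : ∀ i j, i ≤ j → j + 1 < n →
      splitLevel (v i) (v (j + 1)) = splitLevel (v j) (v (j + 1)) := by
    intro i j hij
    induction j, hij using Nat.le_induction with
    | base => exact fun _ => rfl
    | succ j hij ih =>
      intro hn
      rw [splitLevel_eq_max (hv i (j + 1) (by omega) (by omega)) (hv _ (j + 1 + 1) (by omega) hn),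
        ih (by omega), max_eq_right (mono j (j + 1) (by omega) hn).le]
  have lt_of : ∀ i j, i < n → v i < v j → i < j := by
    intro i j hi hij
    by_contra hc
    rcases (not_lt.1 hc).eq_or_lt with rfl | hlt
    · exact lt_irrefl _ hij
    · exact lt_asymm hij (hv j i hlt hi)
  intro z hz y hy x hx hyz hxy
  simp only [Finset.mem_image, Finset.mem_range] at hx hy hz
  obtain ⟨i, hi, rfl⟩ := hx
  obtain ⟨j, hj, rfl⟩ := hy
  obtain ⟨l, hl, rfl⟩ := hz
  have hij := lt_of i j hi hxy
  have hjl := lt_of j l hj hyz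
  obtain ⟨j, rfl⟩ := Nat.exists_eq_add_of_lt (Nat.zero_lt_of_lt hij)
  obtain ⟨l, rfl⟩ := Nat.exists_eq_add_of_lt (Nat.zero_lt_of_lt hjl)
  simp only [zero_add] at *
  rw [splitLevel_comm (v (j + 1)) (v i), last i j (by omega) hj, splitLevel_comm (v (l + 1)),
    last (j + 1) l (by omega) hl]
  exact mono j l (by omega) hl

lemma nth_mem_image_range {u : ℕ → ℕ} {k : ℕ} (hu : ∀ i j, i < j → j < k → u i < u j)
    {i : ℕ} (hi : i < k) : Nat.nth (· ∈ (Finset.range k).image u) i = u i := by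
  classical
  have hc : Nat.count (· ∈ (Finset.range k).image u) (u i) = i := by
    rw [Nat.count_eq_card_filter_range]
    have : (Finset.range (u i)).filter (· ∈ (Finset.range k).image u)
        = (Finset.range i).image u := by
      ext t
      simp only [Finset.mem_filter, Finset.mem_image, Finset.mem_range]
      constructor
      · rintro ⟨hlt, j, hj, rfl⟩
        refine ⟨j, ?_, rfl⟩
        by_contra hc
        rcases (not_lt.1 hc).eq_or_lt with rfl | h
        · exact lt_irrefl _ hlt
        · exact lt_asymm hlt (hu i j h hj)
      · rintro ⟨j, hj, rfl⟩
        exact ⟨hu j i hj hi, j, by omega, rfl⟩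
    rw [this, Finset.card_image_of_injOn, Finset.card_range]
    intro a ha b hb hab
    simp only [Finset.coe_range, Set.mem_Iio] at ha hb
    rcases lt_trichotomy a b with h | h | h
    · exact absurd hab (hu a b h (by omega)).ne
    · exact h
    · exact absurd hab (hu b a h (by omega)).ne'
  have := Nat.nth_count (p := (· ∈ (Finset.range k).image u)) (n := u i)
    (Finset.mem_image_of_mem u (Finset.mem_range.2 hi))
  rwa [hc] at this

lemma card_image_range {u : ℕ → ℕ} {k : ℕ} (hu : ∀ i j, i < j → j < k → u i < u j) :
    ((Finset.range k).image u).card = k := by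
  rw [Finset.card_image_of_injOn, Finset.card_range]
  intro a ha b hb hab
  simp only [Finset.coe_range, Set.mem_Iio] at ha hb
  rcases lt_trichotomy a b with h | h | h
  · exact absurd hab (hu a b h (by omega)).ne
  · exact h
  · exact absurd hab (hu b a h (by omega)).ne'

lemma exists_enumeration (S : Finset ℕ) :
    ∃ v : ℕ → ℕ, (∀ i j, i < j → j < S.card → v i < v j) ∧
      S = (Finset.range S.card).image v := by
  let v : ℕ → ℕ := fun i => if h : i < S.card then S.orderEmbOfFin rfl ⟨i, h⟩ else 0
  have hv : ∀ i j, i < j → j < S.card → v i < v j := by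
    intro i j hij hj
    simp only [v, dif_pos hj, dif_pos (hij.trans hj)]
    exact (S.orderEmbOfFin rfl).strictMono hij
  refine ⟨v, hv, (Finset.eq_of_subset_of_card_le ?_ (card_image_range hv).ge).symm⟩
  intro t ht
  obtain ⟨i, hi, rfl⟩ := Finset.mem_image.1 ht
  simp only [v, dif_pos (Finset.mem_range.1 hi)]
  exact S.orderEmbOfFin_mem rfl _

/-- The order patterns of five consecutive split levels that make a non-monotone edge of the
stepped-up hypergraph. -/
def Zigzag (a b c d e : ℕ) : Prop :=
  (a < b ∧ c < b ∧ c < d ∧ e < d) ∨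
  (b < a ∧ b < c ∧ d < c ∧ d < e ∧ ¬ (a < c ∧ e < c)) ∨
  (b < a ∧ c < b ∧ c < d ∧ e < d) ∨
  (b < a ∧ b < c ∧ c < d ∧ e < d) ∨
  (b < a ∧ b < c ∧ d < c ∧ e < d)

/-- The first five split levels along the sequence `u` form a zigzag. -/
def ZigzagStart (u : ℕ → ℕ) : Prop :=
  Zigzag (splitLevel (u 0) (u 1)) (splitLevel (u 1) (u 2)) (splitLevel (u 2) (u 3))
    (splitLevel (u 3) (u 4)) (splitLevel (u 4) (u 5))

/-- The stepped-up hypergraph: an edge either has split levels that are monotone and form an edge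
of `H`, or starts with a zigzag. -/
def stepUp (H : Finset ℕ → Prop) (e : Finset ℕ) : Prop :=
  ((LevelDecreasing (· < ·) e ∨ LevelDecreasing (· > ·) e) ∧ H (levels e)) ∨
    ZigzagStart (Nat.nth (· ∈ e))

lemma zigzagStart_nth_iff {u : ℕ → ℕ} {k : ℕ} (hk : 6 ≤ k)
    (hu : ∀ i j, i < j → j < k → u i < u j) :
    ZigzagStart (Nat.nth (· ∈ (Finset.range k).image u)) ↔ ZigzagStart u := by
  unfold ZigzagStart
  rw [nth_mem_image_range hu (show 0 < k by omega), nth_mem_image_range hu (show 1 < k by omega),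
    nth_mem_image_range hu (show 2 < k by omega), nth_mem_image_range hu (show 3 < k by omega),
    nth_mem_image_range hu (show 4 < k by omega), nth_mem_image_range hu (show 5 < k by omega)]

lemma stepUp_image {H : Finset ℕ → Prop} {u : ℕ → ℕ} {k : ℕ} (hk : 6 ≤ k)
    (hu : ∀ i j, i < j → j < k → u i < u j) (h : stepUp H ((Finset.range k).image u)) :
    ZigzagStart u ∨
    (∀ i, i + 2 < k → splitLevel (u (i + 1)) (u (i + 2)) < splitLevel (u i) (u (i + 1))) ∨
    (∀ i, i + 2 < k → splitLevel (u i) (u (i + 1)) < splitLevel (u (i + 1)) (u (i + 2))) := by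
  have hmem : ∀ i, i < k → u i ∈ (Finset.range k).image u := fun i hi =>
    Finset.mem_image_of_mem u (Finset.mem_range.2 hi)
  rcases h with ⟨h | h, -⟩ | h
  · exact Or.inr <| Or.inl fun i hi => h _ (hmem i (by omega)) _ (hmem (i + 1) (by omega)) _
      (hmem (i + 2) hi) (hu _ _ (by omega) (by omega)) (hu _ _ (by omega) hi)
  · refine Or.inr <| Or.inr fun i hi => ?_
    have := h _ (hmem (i + 2) hi) _ (hmem (i + 1) (by omega)) _ (hmem i (by omega))
      (hu _ _ (by omega) hi) (hu _ _ (by omega) (by omega))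
    rwa [splitLevel_comm (u (i + 1)), splitLevel_comm (u (i + 2))] at this
  · exact Or.inl ((zigzagStart_nth_iff hk hu).1 h)

/-- For `p ≤ q`, the increasing map omitting exactly the values `p` and `q + 1`. -/
def skipTwo (p q i : ℕ) : ℕ := if i < p then i else if i < q then i + 1 else i + 2

lemma stepUp_skipTwo {H : Finset ℕ → Prop} {v : ℕ → ℕ} {k : ℕ} (hk : 6 ≤ k)
    (hv : ∀ i j, i < j → j < k + 2 → v i < v j)
    (h : ∀ e ⊆ (Finset.range (k + 2)).image v, e.card = k → stepUp H e) (p q : ℕ) :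
    ZigzagStart (fun i => v (skipTwo p q i)) ∨
    (∀ i, i + 2 < k → splitLevel (v (skipTwo p q (i + 1))) (v (skipTwo p q (i + 2))) <
      splitLevel (v (skipTwo p q i)) (v (skipTwo p q (i + 1)))) ∨
    (∀ i, i + 2 < k → splitLevel (v (skipTwo p q i)) (v (skipTwo p q (i + 1))) <
      splitLevel (v (skipTwo p q (i + 1))) (v (skipTwo p q (i + 2)))) := by
  have hu : ∀ i j, i < j → j < k → v (skipTwo p q i) < v (skipTwo p q j) := by
    intro i j hij hj
    apply hv <;> unfold skipTwo <;> split_ifs <;> omega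
  refine stepUp_image (H := H) hk hu (h _ ?_ (card_image_range hu))
  intro t ht
  obtain ⟨i, hi, rfl⟩ := Finset.mem_image.1 ht
  refine Finset.mem_image_of_mem v (Finset.mem_range.2 ?_)
  have := Finset.mem_range.1 hi
  unfold skipTwo
  split_ifs <;> omega

lemma not_zigzagStart_of_decreasing {r : ℕ → ℕ → Prop} (hr : r = (· < ·) ∨ r = (· > ·))
    {e : Finset ℕ} (he : 6 ≤ e.card) (h : LevelDecreasing r e) :
    ¬ ZigzagStart (Nat.nth (· ∈ e)) := by
  obtain ⟨u, hu, heq⟩ := exists_enumeration e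
  rw [heq, zigzagStart_nth_iff he hu]
  have hmem : ∀ i, i < e.card → u i ∈ e := fun i hi => by
    have := Finset.mem_image_of_mem u (Finset.mem_range.2 hi)
    rwa [← heq] at this
  have m0 := hmem 0 (by omega)
  have m1 := hmem 1 (by omega)
  have m2 := hmem 2 (by omega)
  have m3 := hmem 3 (by omega)
  have m4 := hmem 4 (by omega)
  have u01 := hu 0 1 (by omega) (by omega)
  have u12 := hu 1 2 (by omega) (by omega)
  have u23 := hu 2 3 (by omega) (by omega)
  have u34 := hu 3 4 (by omega) (by omega)
  unfold ZigzagStart Zigzag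
  rcases hr with rfl | rfl
  · have h1 := h _ m0 _ m1 _ m2 u01 u12
    have h2 := h _ m1 _ m2 _ m3 u12 u23
    have h3 := h _ m2 _ m3 _ m4 u23 u34
    omega
  · have h1 := h _ m2 _ m1 _ m0 u12 u01
    have h2 := h _ m3 _ m2 _ m1 u23 u12
    have h3 := h _ m4 _ m3 _ m2 u34 u23
    rw [splitLevel_comm (u 1), splitLevel_comm (u 2)] at h1
    rw [splitLevel_comm (u 2), splitLevel_comm (u 3)] at h2
    rw [splitLevel_comm (u 3), splitLevel_comm (u 4)] at h3
    omega

/-- A clique of the stepped-up hypergraph with monotone split levels gives a clique of `H` with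
one vertex fewer. -/
lemma clique_levels {H : Finset ℕ → Prop} {r : ℕ → ℕ → Prop} (hr : r = (· < ·) ∨ r = (· > ·))
    {k : ℕ} (hk : 6 ≤ k) {S : Finset ℕ} (hS : S.Nonempty) (hdec : LevelDecreasing r S)
    (h : ∀ e ⊆ S, e.card = k → stepUp H e) :
    ∀ t ⊆ levels S, t.card = k - 1 → H t := by
  intro t ht hcard
  obtain ⟨e, heS, rfl, hek⟩ := hdec.exists_levels_eq hr hS ht
  rcases h e heS (by omega) with h1 | h1
  · exact h1.2
  · exact absurd h1 (not_zigzagStart_of_decreasing hr (by omega) (hdec.mono heS))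

lemma not_all_zigzag {v : ℕ → ℕ} {k : ℕ} (hk : 6 ≤ k)
    (hv : ∀ i j, i < j → j < k + 2 → v i < v j) {H : Finset ℕ → Prop}
    (h : ∀ e ⊆ (Finset.range (k + 2)).image v, e.card = k → stepUp H e)
    (h0 : ZigzagStart v) (h2 : ZigzagStart fun i => v (i + 2)) : False := by
  have m24 := splitLevel_eq_max (hv 2 3 (by omega) (by omega)) (hv 3 4 (by omega) (by omega))
  have m13 := splitLevel_eq_max (hv 1 2 (by omega) (by omega)) (hv 2 3 (by omega) (by omega))
  have m35 := splitLevel_eq_max (hv 3 4 (by omega) (by omega)) (hv 4 5 (by omega) (by omega))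
  have aux : ∀ p q,
      (∃ a b c d e, a = splitLevel (v (skipTwo p q 0)) (v (skipTwo p q 1)) ∧
        b = splitLevel (v (skipTwo p q 1)) (v (skipTwo p q 2)) ∧
        c = splitLevel (v (skipTwo p q 2)) (v (skipTwo p q 3)) ∧
        d = splitLevel (v (skipTwo p q 3)) (v (skipTwo p q 4)) ∧
        e = splitLevel (v (skipTwo p q 4)) (v (skipTwo p q 5)) ∧
        (Zigzag a b c d e ∨ (b < a ∧ c < b ∧ d < c ∧ e < d) ∨
          (a < b ∧ b < c ∧ c < d ∧ d < e))) := by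
    intro p q
    refine ⟨_, _, _, _, _, rfl, rfl, rfl, rfl, rfl, ?_⟩
    rcases stepUp_skipTwo hk hv h p q with h | h | h
    · exact Or.inl h
    · exact Or.inr (Or.inl ⟨h 0 (by omega), h 1 (by omega), h 2 (by omega), h 3 (by omega)⟩)
    · exact Or.inr (Or.inr ⟨h 0 (by omega), h 1 (by omega), h 2 (by omega), h 3 (by omega)⟩)
  have k0 : 0 < k := by omega
  have k1 : 1 < k := by omega
  have k2 : 2 < k := by omega
  have k3 : 3 < k := by omega
  have k4 : 4 < k := by omega
  have k5 : 5 < k := by omega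
  have e3 := aux 3 k
  have e03 := aux 0 3
  have e2 := aux 2 k
  have e4 := aux 4 k
  have e0 := aux 0 k
  simp [skipTwo, k0, k1, k2, k3, k4, k5] at e3 e03 e2 e4 e0
  unfold ZigzagStart at h0 h2
  norm_num at h0 h2
  unfold Zigzag at *
  by_cases w0 : splitLevel (v 0) (v 1) < splitLevel (v 1) (v 2)
  · clear e03 e2 e4 e0 m13 m35 h2
    omega
  by_cases w1 : splitLevel (v 1) (v 2) < splitLevel (v 2) (v 3)
  · clear e2 e4 e3 m13 m24
    omega
  · clear e3 e03 m24
    omega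

lemma stepUp_window {H : Finset ℕ → Prop} {v : ℕ → ℕ} {k : ℕ} (hk : 6 ≤ k)
    (hv : ∀ i j, i < j → j < k + 2 → v i < v j)
    (h : ∀ e ⊆ (Finset.range (k + 2)).image v, e.card = k → stepUp H e) (t : ℕ) (ht : t ≤ 2) :
    ZigzagStart (fun i => v (i + t)) ∨
    (∀ i, i + 2 < k → splitLevel (v (i + 1 + t)) (v (i + 2 + t)) <
      splitLevel (v (i + t)) (v (i + 1 + t))) ∨
    (∀ i, i + 2 < k → splitLevel (v (i + t)) (v (i + 1 + t)) <
      splitLevel (v (i + 1 + t)) (v (i + 2 + t))) := by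
  have hu : ∀ i j, i < j → j < k → v (i + t) < v (j + t) :=
    fun i j hij hj => hv _ _ (by omega) (by omega)
  refine stepUp_image (H := H) (u := fun i => v (i + t)) hk hu (h _ ?_ (card_image_range hu))
  intro x hx
  obtain ⟨i, hi, rfl⟩ := Finset.mem_image.1 hx
  have := Finset.mem_range.1 hi
  exact Finset.mem_image_of_mem v (Finset.mem_range.2 (by omega))

lemma levelDecreasing_of_clique {H : Finset ℕ → Prop} {v : ℕ → ℕ} {k : ℕ} (hk : 6 ≤ k)
    (hv : ∀ i j, i < j → j < k + 2 → v i < v j)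
    (h : ∀ e ⊆ (Finset.range (k + 2)).image v, e.card = k → stepUp H e) :
    LevelDecreasing (· < ·) ((Finset.range (k + 2)).image v) ∨
      LevelDecreasing (· > ·) ((Finset.range (k + 2)).image v) := by
  have W0 := stepUp_window hk hv h 0 (by omega)
  have W1 := stepUp_window hk hv h 1 (by omega)
  have W2 := stepUp_window hk hv h 2 (by omega)
  have hno := not_all_zigzag hk hv h
  have l0 : 0 + 2 < k := by omega
  have l1 : 1 + 2 < k := by omega
  have l2 : 2 + 2 < k := by omega
  have l3 : 3 + 2 < k := by omega
  by_cases hdec : ∀ i, i + 2 < k + 2 →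
      splitLevel (v (i + 1)) (v (i + 2)) < splitLevel (v i) (v (i + 1))
  · exact Or.inl (levelDecreasing_lt_image hv hdec)
  by_cases hinc : ∀ i, i + 2 < k + 2 →
      splitLevel (v i) (v (i + 1)) < splitLevel (v (i + 1)) (v (i + 2))
  · exact Or.inr (levelDecreasing_gt_image hv hinc)
  exfalso
  rcases W0 with W0 | W0 | W0 <;> rcases W2 with W2 | W2 | W2
  · exact hno W0 W2
  all_goals rcases W1 with W1 | W1 | W1
  all_goals first
    | (apply hdec
       intro i hi
       rcases i with _ | _ | i
       · exact W0 0 (by omega)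
       · exact W1 0 (by omega)
       · exact W2 i (by omega))
    | (apply hinc
       intro i hi
       rcases i with _ | _ | i
       · exact W0 0 (by omega)
       · exact W1 0 (by omega)
       · exact W2 i (by omega))
    | (clear hno hdec hinc h
       try (have a0 := W0 0 l0; have a1 := W0 1 l1
            have a2 := W0 2 l2; have a3 := W0 3 l3; clear W0)
       try (have b0 := W1 0 l0; have b1 := W1 1 l1
            have b2 := W1 2 l2; have b3 := W1 3 l3; clear W1)
       try (have c0 := W2 0 l0; have c1 := W2 1 l1
            have c2 := W2 2 l2; have c3 := W2 3 l3; clear W2)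
       try unfold ZigzagStart Zigzag at *
       norm_num at *
       omega)

lemma stepUp_cliqueFree {H : Finset ℕ → Prop} {k N : ℕ} (hk : 6 ≤ k) (hN : 1 ≤ N)
    (hH : ¬ ∃ T ⊆ Finset.range N, T.card = k + 1 ∧ ∀ t ⊆ T, t.card = k - 1 → H t) :
    ¬ ∃ S ⊆ Finset.range (2 ^ N), S.card = k + 2 ∧ ∀ e ⊆ S, e.card = k → stepUp H e := by
  rintro ⟨S, hSN, hcard, hS⟩
  obtain ⟨v, hv, heq⟩ := exists_enumeration S
  rw [hcard] at hv heq
  have hne : S.Nonempty := Finset.card_pos.1 (by omega)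
  have hd := levelDecreasing_of_clique (H := H) hk hv (by rwa [← heq])
  rw [← heq] at hd
  have key : ∀ r : ℕ → ℕ → Prop, (r = (· < ·) ∨ r = (· > ·)) → LevelDecreasing r S → False := by
    intro r hr hdec
    refine hH ⟨levels S, levels_subset_range hN hSN, ?_, clique_levels hr hk hne hdec hS⟩
    rw [hdec.card_levels hr, hcard]
    rfl
  rcases hd with hd | hd
  · exact key _ (Or.inl rfl) hd
  · exact key _ (Or.inr rfl) hd

/-- A large set with monotone split levels contains a clique of the stepped-up hypergraph. -/
lemma exists_clique_of_decreasing {H : Finset ℕ → Prop} {r : ℕ → ℕ → Prop}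
    (hr : r = (· < ·) ∨ r = (· > ·)) {k m N : ℕ} (hN : 1 ≤ N)
    (hH : ∀ W ⊆ Finset.range N, m < W.card →
      ∃ T ⊆ W, T.card = k ∧ ∀ t ⊆ T, t.card = k - 1 → H t)
    {A : Finset ℕ} (hA : A ⊆ Finset.range (2 ^ N)) (hcard : A.card = m + 2)
    (hdec : LevelDecreasing r A) :
    ∃ S ⊆ A, S.card = k + 1 ∧ ∀ e ⊆ S, e.card = k → stepUp H e := by
  have hne : A.Nonempty := Finset.card_pos.1 (by omega)
  obtain ⟨T, hT, hTk, hTH⟩ := hH (levels A) (levels_subset_range hN hA)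
    (by rw [hdec.card_levels hr]; omega)
  obtain ⟨S, hSA, rfl, hSk⟩ := hdec.exists_levels_eq hr hne hT
  refine ⟨S, hSA, by omega, fun e he hek => Or.inl ⟨?_, hTH _ (levels_mono he) ?_⟩⟩
  · have := hdec.mono (he.trans hSA)
    rcases hr with rfl | rfl
    · exact Or.inl this
    · exact Or.inr this
  · rw [(hdec.mono (he.trans hSA)).card_levels hr, hek]

/-- Seven initial points whose split levels alternate, starting with a local maximum, such that
the middle one of the three maxima is not the largest, extend to a clique. -/
lemma clique_of_alternating (H : Finset ℕ → Prop) {u : ℕ → ℕ} {k : ℕ} (hk : 6 ≤ k)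
    (hu : ∀ i j, i < j → j < k + 1 → u i < u j)
    (h0 : splitLevel (u 1) (u 2) < splitLevel (u 0) (u 1))
    (h1 : splitLevel (u 1) (u 2) < splitLevel (u 2) (u 3))
    (h2 : splitLevel (u 3) (u 4) < splitLevel (u 2) (u 3))
    (h3 : splitLevel (u 3) (u 4) < splitLevel (u 4) (u 5))
    (h4 : splitLevel (u 5) (u 6) < splitLevel (u 4) (u 5))
    (hpeak : ¬ (splitLevel (u 0) (u 1) < splitLevel (u 2) (u 3) ∧
      splitLevel (u 4) (u 5) < splitLevel (u 2) (u 3))) :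
    ∀ e ⊆ (Finset.range (k + 1)).image u, e.card = k → stepUp H e := by
  intro e he hek
  obtain ⟨p, hp, hpe⟩ : ∃ p < k + 1, u p ∉ e := by
    by_contra hc
    push Not at hc
    have : (Finset.range (k + 1)).image u ⊆ e := by
      intro x hx
      obtain ⟨i, hi, rfl⟩ := Finset.mem_image.1 hx
      exact hc i (Finset.mem_range.1 hi)
    have := Finset.card_le_card this
    rw [card_image_range hu] at this
    omega
  have hw : ∀ i j, i < j → j < k →
      u (if i < p then i else i + 1) < u (if j < p then j else j + 1) := by
    intro i j hij hj
    apply hu <;> split_ifs <;> omega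
  have heq : e = (Finset.range k).image fun i => u (if i < p then i else i + 1) := by
    refine Finset.eq_of_subset_of_card_le ?_ (by rw [card_image_range hw, hek])
    intro x hx
    obtain ⟨i, hi, rfl⟩ := Finset.mem_image.1 (he hx)
    have hi' := Finset.mem_range.1 hi
    have hip : i ≠ p := by
      rintro rfl
      exact hpe hx
    refine Finset.mem_image.2 ⟨if i < p then i else i - 1, Finset.mem_range.2 ?_, ?_⟩
    · split_ifs <;> omega
    · congr 1
      split_ifs <;> omega
  right
  rw [heq, zigzagStart_nth_iff hk hw]
  have m02 := splitLevel_eq_max (hu 0 1 (by omega) (by omega)) (hu 1 2 (by omega) (by omega))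
  have m13 := splitLevel_eq_max (hu 1 2 (by omega) (by omega)) (hu 2 3 (by omega) (by omega))
  have m24 := splitLevel_eq_max (hu 2 3 (by omega) (by omega)) (hu 3 4 (by omega) (by omega))
  have m35 := splitLevel_eq_max (hu 3 4 (by omega) (by omega)) (hu 4 5 (by omega) (by omega))
  have m46 := splitLevel_eq_max (hu 4 5 (by omega) (by omega)) (hu 5 6 (by omega) (by omega))
  have n1 := splitLevel_ne (hu 0 1 (by omega) (by omega)) (hu 1 3 (by omega) (by omega))
  have n2 := splitLevel_ne (hu 2 3 (by omega) (by omega)) (hu 3 5 (by omega) (by omega))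
  rw [max_eq_left h0.le] at m02
  rw [max_eq_right h1.le] at m13
  rw [max_eq_left h2.le] at m24
  rw [max_eq_right h3.le] at m35
  rw [max_eq_left h4.le] at m46
  rw [m13] at n1
  rw [m35] at n2
  unfold ZigzagStart Zigzag
  rcases p with _ | _ | _ | _ | _ | _ | p
  · norm_num
    exact Or.inl ⟨h1, h2, h3, h4⟩
  · norm_num [m02]
    rcases lt_or_gt_of_ne n1 with h | h
    · exact Or.inl ⟨h, h2, h3, h4⟩
    · exact Or.inr (Or.inr (Or.inl ⟨h, h2, h3, h4⟩))
  · norm_num [m13]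
    rcases lt_or_gt_of_ne n1 with h | h
    · exact Or.inl ⟨h, h2, h3, h4⟩
    · exact Or.inr (Or.inr (Or.inl ⟨h, h2, h3, h4⟩))
  · norm_num [m24]
    rcases lt_or_gt_of_ne n2 with h | h
    · exact Or.inr (Or.inr (Or.inr (Or.inl ⟨h0, h1, h, h4⟩)))
    · exact Or.inr (Or.inr (Or.inr (Or.inr ⟨h0, h1, h, h4⟩)))
  · norm_num [m35]
    rcases lt_or_gt_of_ne n2 with h | h
    · exact Or.inr (Or.inr (Or.inr (Or.inl ⟨h0, h1, h, h4⟩)))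
    · exact Or.inr (Or.inr (Or.inr (Or.inr ⟨h0, h1, h, h4⟩)))
  · norm_num [m46]
    exact Or.inr (Or.inl ⟨h0, h1, h2, h3, fun h => not_lt.1 fun h' => hpeak ⟨h, h'⟩⟩)
  · norm_num [show 2 < p + 6 by omega, show 3 < p + 6 by omega, show 4 < p + 6 by omega,
      show 5 < p + 6 by omega]
    exact Or.inr (Or.inl ⟨h0, h1, h2, h3, fun h => not_lt.1 fun h' => hpeak ⟨h, h'⟩⟩)

lemma splitLevel_le_splitLevel {x y z w : ℕ} (hxy : x ≤ y) (hyz : y ≤ z) (hzw : z ≤ w) :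
    splitLevel y z ≤ splitLevel x w := by
  rw [splitLevel_le_iff]
  have h := (splitLevel_le_iff x w _).1 le_rfl
  have h1 := Nat.div_le_div_right (c := 2 ^ (splitLevel x w + 1)) hxy
  have h2 := Nat.div_le_div_right (c := 2 ^ (splitLevel x w + 1)) hyz
  have h3 := Nat.div_le_div_right (c := 2 ^ (splitLevel x w + 1)) hzw
  omega

/-- The indices of a point `p`, of the two ends of the gaps starting at `q`, `r` and `s`, and of
all points after these. -/
def gapIndex (p q r s : ℕ) : ℕ → ℕ
  | 0 => p
  | 1 => q
  | 2 => q + 1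
  | 3 => r
  | 4 => r + 1
  | 5 => s
  | i + 6 => s + 1 + i

lemma gapIndex_strictMono {p q r s : ℕ} (hpq : p < q) (hqr : q + 1 < r) (hrs : r + 1 < s) :
    StrictMono (gapIndex p q r s) := by
  refine strictMono_nat_of_lt_succ fun i => ?_
  rcases i with _ | _ | _ | _ | _ | _ | i <;> simp only [gapIndex] <;> omega

lemma exists_clique_of_gaps (H : Finset ℕ → Prop) {a : ℕ → ℕ} {k n : ℕ} (hk : 6 ≤ k)
    (ha : ∀ i j, i < j → j < n → a i < a j) {p q r s : ℕ}
    (hpq : p < q) (hqr : q + 1 < r) (hrs : r + 1 < s) (hs : s + (k - 6) + 1 < n)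
    (h0 : splitLevel (a q) (a (q + 1)) < splitLevel (a p) (a q))
    (h1 : splitLevel (a q) (a (q + 1)) < splitLevel (a (q + 1)) (a r))
    (h2 : splitLevel (a r) (a (r + 1)) < splitLevel (a (q + 1)) (a r))
    (h3 : splitLevel (a r) (a (r + 1)) < splitLevel (a (r + 1)) (a s))
    (h4 : splitLevel (a s) (a (s + 1)) < splitLevel (a (r + 1)) (a s))
    (hpeak : ¬ (splitLevel (a p) (a q) < splitLevel (a (q + 1)) (a r) ∧
      splitLevel (a (r + 1)) (a s) < splitLevel (a (q + 1)) (a r))) :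
    ∃ S ⊆ (Finset.range n).image a, S.card = k + 1 ∧ ∀ e ⊆ S, e.card = k → stepUp H e := by
  have hg := gapIndex_strictMono hpq hqr hrs
  have hlast : gapIndex p q r s k < n := by
    obtain ⟨i, rfl⟩ := Nat.exists_eq_add_of_le' hk
    simp only [gapIndex]
    omega
  have hbound : ∀ i, i < k + 1 → gapIndex p q r s i < n := fun i hi =>
    (hg.monotone (Nat.le_of_lt_succ hi)).trans_lt hlast
  have hu : ∀ i j, i < j → j < k + 1 → a (gapIndex p q r s i) < a (gapIndex p q r s j) :=
    fun i j hij hj => ha _ _ (hg hij) (hbound j hj)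
  refine ⟨(Finset.range (k + 1)).image fun i => a (gapIndex p q r s i), ?_, card_image_range hu,
    clique_of_alternating H hk hu h0 h1 h2 h3 h4 hpeak⟩
  intro x hx
  obtain ⟨i, hi, rfl⟩ := Finset.mem_image.1 hx
  exact Finset.mem_image_of_mem a (Finset.mem_range.2 (hbound i (Finset.mem_range.1 hi)))

/-- If neither `m` consecutive ascents nor `m` consecutive descents occur in `d`, every long enough
interval contains a local minimum. -/
lemma exists_local_min {d : ℕ → ℕ} {m n : ℕ} (hm : 1 ≤ m)
    (hne : ∀ i, i + 2 < n → d i ≠ d (i + 1))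
    (hdesc : ∀ p, p + m + 2 ≤ n → ∃ i, p ≤ i ∧ i < p + m ∧ d (i + 1) < d i)
    (hasc : ∀ p, p + m + 2 ≤ n → ∃ i, p ≤ i ∧ i < p + m ∧ d i < d (i + 1))
    (p : ℕ) (hp : p + 2 * m + 1 ≤ n) :
    ∃ q, p ≤ q ∧ q + 3 ≤ p + 2 * m ∧ d (q + 1) < d q ∧ d (q + 1) < d (q + 2) := by
  obtain ⟨i, hpi, him, hi⟩ := hdesc p (by omega)
  have hex : ∃ l, i ≤ l ∧ d l < d (l + 1) := by
    obtain ⟨l, hl, -, h⟩ := hasc i (by omega)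
    exact ⟨l, hl, h⟩
  obtain ⟨l', hl', hlm', h'⟩ := hasc i (by omega)
  have hle : Nat.find hex ≤ l' := Nat.find_min' hex ⟨hl', h'⟩
  obtain ⟨hil, hl⟩ := Nat.find_spec hex
  have hmin : ∀ l < Nat.find hex, ¬ (i ≤ l ∧ d l < d (l + 1)) := fun l h => Nat.find_min hex h
  generalize Nat.find hex = l at *
  rcases hil.eq_or_lt with rfl | hlt
  · omega
  obtain ⟨q, rfl⟩ := Nat.exists_eq_add_of_lt (Nat.zero_lt_of_lt hlt)
  rw [zero_add] at *
  have h1 := hmin q (by omega)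
  have h2 := hne q (by omega)
  exact ⟨q, by omega, by omega, by omega, hl⟩

/-- Every large set contains a clique of the stepped-up hypergraph. -/
lemma exists_clique_of_card {H : Finset ℕ → Prop} {k m N : ℕ} (hk : 6 ≤ k) (hm : 1 ≤ m)
    (hN : 1 ≤ N)
    (hH : ∀ W ⊆ Finset.range N, m < W.card →
      ∃ T ⊆ W, T.card = k ∧ ∀ t ⊆ T, t.card = k - 1 → H t)
    {A : Finset ℕ} (hA : A ⊆ Finset.range (2 ^ N)) (hcard : (k + 2) * m ≤ A.card) :
    ∃ S ⊆ A, S.card = k + 1 ∧ ∀ e ⊆ S, e.card = k → stepUp H e := by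
  by_contra hno
  obtain ⟨a, ha, heq⟩ := exists_enumeration A
  set n := A.card
  have hn : 8 * m + (k - 6) ≤ n := by
    obtain ⟨c, rfl⟩ := Nat.exists_eq_add_of_le hk
    have : c * 1 ≤ c * m := Nat.mul_le_mul_left c hm
    calc 8 * m + (6 + c - 6) ≤ (6 + c + 2) * m := by
          rw [show (6 + c + 2) * m = 8 * m + c * m by ring]
          omega
      _ ≤ n := hcard
  have hrun : ∀ p, p + m + 2 ≤ n →
      (Finset.range (m + 2)).image (fun i => a (i + p)) ⊆ A := by
    intro p hp x hx
    obtain ⟨i, hi, rfl⟩ := Finset.mem_image.1 hx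
    rw [heq]
    have := Finset.mem_range.1 hi
    exact Finset.mem_image_of_mem a (Finset.mem_range.2 (by omega))
  have hmono : ∀ p, p + m + 2 ≤ n → ∀ i j, i < j → j < m + 2 → a (i + p) < a (j + p) :=
    fun p hp i j hij hj => ha _ _ (by omega) (by omega)
  have hnodec : ∀ (r : ℕ → ℕ → Prop), (r = (· < ·) ∨ r = (· > ·)) → ∀ p, p + m + 2 ≤ n →
      ¬ LevelDecreasing r ((Finset.range (m + 2)).image fun i => a (i + p)) := by
    intro r hr p hp hdec
    obtain ⟨S, hS, h⟩ := exists_clique_of_decreasing hr hN hH ((hrun p hp).trans hA)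
      (card_image_range (hmono p hp)) hdec
    exact hno ⟨S, hS.trans (hrun p hp), h⟩
  have hne : ∀ i, i + 2 < n →
      splitLevel (a i) (a (i + 1)) ≠ splitLevel (a (i + 1)) (a (i + 1 + 1)) := fun i hi =>
    splitLevel_ne (ha _ _ (by omega) (by omega)) (ha _ _ (by omega) (by omega))
  have hmin := exists_local_min (d := fun i => splitLevel (a i) (a (i + 1))) (m := m) hm hne
    (by
      intro p hp
      by_contra hc
      push Not at hc
      refine hnodec _ (Or.inr rfl) p hp (levelDecreasing_gt_image (hmono p hp) fun i hi => ?_)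
      have h1 := hc (i + p) (by omega) (by omega)
      have h2 := hne (i + p) (by omega)
      rw [show i + 1 + p = i + p + 1 by omega, show i + 2 + p = i + p + 1 + 1 by omega]
      exact lt_of_le_of_ne h1 h2)
    (by
      intro p hp
      by_contra hc
      push Not at hc
      refine hnodec _ (Or.inl rfl) p hp (levelDecreasing_lt_image (hmono p hp) fun i hi => ?_)
      have h1 := hc (i + p) (by omega) (by omega)
      have h2 := hne (i + p) (by omega)
      rw [show i + 1 + p = i + p + 1 by omega, show i + 2 + p = i + p + 1 + 1 by omega]
      exact lt_of_le_of_ne h1 h2.symm)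
  simp only [add_assoc, Nat.reduceAdd] at hmin
  have gap : ∀ q r, q + 2 ≤ r → r + 2 < n →
      splitLevel (a (q + 1)) (a (q + 2)) < splitLevel (a (q + 2)) (a (q + 3)) →
      splitLevel (a (r + 1)) (a (r + 2)) < splitLevel (a r) (a (r + 1)) →
      splitLevel (a (q + 1)) (a (q + 2)) < splitLevel (a (q + 2)) (a (r + 1)) ∧
      splitLevel (a (r + 1)) (a (r + 2)) < splitLevel (a (q + 2)) (a (r + 1)) := by
    intro q r hqr hr h1 h2
    have hle : ∀ i j, i ≤ j → j < n → a i ≤ a j := by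
      intro i j hij hj
      rcases hij.eq_or_lt with rfl | hlt
      · exact le_rfl
      · exact (ha i j hlt hj).le
    exact ⟨h1.trans_le (splitLevel_le_splitLevel le_rfl (hle _ _ (by omega) (by omega))
        (hle _ _ (by omega) (by omega))),
      h2.trans_le (splitLevel_le_splitLevel (hle _ _ (by omega) (by omega))
        (hle _ _ (by omega) (by omega)) le_rfl)⟩
  obtain ⟨q₁, -, hb₁, l₁, r₁⟩ := hmin 0 (by omega)
  obtain ⟨q₂, ha₂, hb₂, l₂, r₂⟩ := hmin (q₁ + 1) (by omega)
  obtain ⟨q₃, ha₃, hb₃, l₃, r₃⟩ := hmin (q₂ + 1) (by omega)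
  obtain ⟨q₄, ha₄, hb₄, l₄, r₄⟩ := hmin (q₃ + 1) (by omega)
  have hsep : ∀ q r, q + 1 ≤ r →
      splitLevel (a (q + 1)) (a (q + 2)) < splitLevel (a (q + 2)) (a (q + 3)) →
      splitLevel (a (r + 1)) (a (r + 2)) < splitLevel (a r) (a (r + 1)) → q + 2 ≤ r := by
    intro q r hqr h1 h2
    by_contra hc
    obtain rfl : r = q + 1 := by omega
    exact lt_asymm h1 h2
  have s₂ := hsep _ _ ha₂ r₁ l₂
  have s₃ := hsep _ _ ha₃ r₂ l₃
  have s₄ := hsep _ _ ha₄ r₃ l₄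
  obtain ⟨x₁, y₁⟩ := gap q₁ q₂ s₂ (by omega) r₁ l₂
  obtain ⟨x₂, y₂⟩ := gap q₂ q₃ s₃ (by omega) r₂ l₃
  obtain ⟨x₃, y₃⟩ := gap q₃ q₄ s₄ (by omega) r₃ l₄
  rw [heq] at hno
  by_cases hpeak : splitLevel (a (q₂ + 2)) (a (q₃ + 1)) < splitLevel (a (q₁ + 2)) (a (q₂ + 1))
  · exact hno <| exists_clique_of_gaps H hk ha (p := q₁ + 2) (q := q₂ + 1) (r := q₃ + 1)
      (s := q₄ + 1) (by omega) (by omega) (by omega) (by omega) y₁ x₂ y₂ x₃ y₃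
      fun h => lt_asymm h.1 hpeak
  · exact hno <| exists_clique_of_gaps H hk ha (p := q₁) (q := q₁ + 1) (r := q₂ + 1)
      (s := q₃ + 1) (by omega) (by omega) (by omega) (by omega) l₁ x₁ y₁ x₂ y₂
      fun h => hpeak h.2

lemma bddAbove_card_subset_range (N : ℕ) (P : Finset ℕ → Prop) :
    BddAbove {c : ℕ | ∃ W ⊆ Finset.range N, W.card = c ∧ P W} := by
  refine ⟨N, ?_⟩
  rintro c ⟨W, hW, rfl, -⟩
  simpa using Finset.card_le_card hW

/-- For each fixed integer `k ≥ 6` and every positive integer `N`,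
`g(k, 2^N) < (k+2) · g(k-1, N)`. -/
theorem stmt5 : ∀ k : ℕ, 6 ≤ k → ∀ N : ℕ, 1 ≤ N →
    erdosRogersG k (2 ^ N) < (k + 2) * erdosRogersG (k - 1) N := by

  intro k hk N hN
  obtain ⟨H, hfree, hm⟩ : erdosRogersG (k - 1) N ∈ {m : ℕ | ∃ E : Finset ℕ → Prop,
      (¬ ∃ S ⊆ Finset.range N, S.card = k - 1 + 2 ∧ ∀ e ⊆ S, e.card = k - 1 → E e) ∧
      m = sSup {c : ℕ | ∃ W ⊆ Finset.range N, W.card = c ∧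
        ¬ ∃ S ⊆ W, S.card = k - 1 + 1 ∧ ∀ e ⊆ S, e.card = k - 1 → E e}} := by
    refine Nat.sInf_mem ⟨_, fun _ => False, ?_, rfl⟩
    rintro ⟨S, -, hS, h⟩
    obtain ⟨e, he, hcard⟩ := Finset.exists_subset_card_eq (show k - 1 ≤ S.card by omega)
    exact h e he hcard
  rw [show k - 1 + 2 = k + 1 by omega] at hfree
  rw [show k - 1 + 1 = k by omega] at hm
  set m := erdosRogersG (k - 1) N
  have hle : ∀ W ⊆ Finset.range N, m < W.card →
      ∃ T ⊆ W, T.card = k ∧ ∀ t ⊆ T, t.card = k - 1 → H t := by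
    intro W hW hlt
    by_contra hc
    rw [hm] at hlt
    exact absurd (le_csSup (bddAbove_card_subset_range N _) ⟨W, hW, rfl, hc⟩) (not_le.2 hlt)
  have hm1 : 1 ≤ m := by
    by_contra hc
    obtain ⟨T, hT, hTk, -⟩ := hle {0} (by simpa using Nat.pos_of_ne_zero (by omega)) (by simp; omega)
    have := Finset.card_le_card hT
    simp only [Finset.card_singleton] at this
    omega
  have hG : erdosRogersG k (2 ^ N) ≤ sSup {c : ℕ | ∃ W ⊆ Finset.range (2 ^ N), W.card = c ∧
      ¬ ∃ S ⊆ W, S.card = k + 1 ∧ ∀ e ⊆ S, e.card = k → stepUp H e} :=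
    Nat.sInf_le ⟨stepUp H, stepUp_cliqueFree hk hN hfree, rfl⟩
  refine hG.trans_lt ?_
  obtain ⟨W, hW, hWc, hWfree⟩ := Nat.sSup_mem (s := {c : ℕ | ∃ W ⊆ Finset.range (2 ^ N),
      W.card = c ∧ ¬ ∃ S ⊆ W, S.card = k + 1 ∧ ∀ e ⊆ S, e.card = k → stepUp H e})
    ⟨0, ∅, by simp, rfl, by
      rintro ⟨S, hS, hcard, -⟩
      rw [Finset.subset_empty.1 hS] at hcard
      simp at hcard⟩ (bddAbove_card_subset_range _ _)
  rw [← hWc]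
  by_contra hc
  exact hWfree (exists_clique_of_card hk hm1 hN hle hW (not_lt.1 hc))
end

section
/- Let r ≥ 3 and let a_1 < a_2 < ... < a_r be nonnegative integers. Then the maximum of δ_1, ..., δ_{r−1} is attained at a unique index; that is, there do not exist indices 1 ≤ i < j ≤ r−1 with δ_i = δ_j = max_{1 ≤ l ≤ r−1} δ_l. -/
/-- For distinct nonnegative integers `a` and `b`, `bdelta a b` is the largest index `i`
such that the `i`-th binary digits of `a` and `b` differ. -/
noncomputable def bdelta (a b : ℕ) : ℕ := sSup {i | a.testBit i ≠ b.testBit i}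

theorem bddAbove_setOf_testBit_ne (a b : ℕ) : BddAbove {i | a.testBit i ≠ b.testBit i} := by
  refine ⟨a + b, fun i hi => ?_⟩
  by_contra! h
  have hi_lt : i < 2 ^ i := Nat.lt_two_pow_self
  exact hi (by rw [Nat.testBit_eq_false_of_lt (by omega), Nat.testBit_eq_false_of_lt (by omega)])

theorem testBit_bdelta_ne {a b : ℕ} (h : a ≠ b) :
    a.testBit (bdelta a b) ≠ b.testBit (bdelta a b) :=
  Nat.sSup_mem (Nat.exists_testBit_ne_of_ne h) (bddAbove_setOf_testBit_ne a b)

theorem div_two_pow_eq_of_bdelta_lt {a b n : ℕ} (h : bdelta a b < n) :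
    a / 2 ^ n = b / 2 ^ n := by
  refine Nat.eq_of_testBit_eq fun i => ?_
  rw [Nat.testBit_div_two_pow, Nat.testBit_div_two_pow]
  by_contra hne
  have hle : i + n ≤ bdelta a b := le_csSup (bddAbove_setOf_testBit_ne a b) hne
  omega

theorem div_two_pow_bdelta_lt {a b : ℕ} (h : a < b) :
    a / 2 ^ bdelta a b < b / 2 ^ bdelta a b := by
  refine lt_of_le_of_ne (Nat.div_le_div_right h.le) fun heq => testBit_bdelta_ne h.ne ?_
  rw [Nat.testBit_eq_decide_div_mod_eq, Nat.testBit_eq_decide_div_mod_eq, heq]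

/-- Let `r ≥ 3` and `a 1 < a 2 < ⋯ < a r` be nonnegative integers. Then the maximum of
`δ_1, …, δ_{r-1}` (where `δ_i = δ(a_i, a_{i+1})`) is attained at a unique index: there do not
exist `1 ≤ i < j ≤ r-1` with `δ_i = δ_j = max_l δ_l`. -/
theorem stmt6 (r : ℕ) (hr : 3 ≤ r) (a : ℕ → ℕ)
    (ha : ∀ i, 1 ≤ i → i < r → a i < a (i + 1)) :
    ¬ ∃ i j : ℕ, 1 ≤ i ∧ i < j ∧ j ≤ r - 1 ∧
      bdelta (a i) (a (i + 1)) = bdelta (a j) (a (j + 1)) ∧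
      ∀ l, 1 ≤ l → l ≤ r - 1 → bdelta (a l) (a (l + 1)) ≤ bdelta (a i) (a (i + 1)) := by
  rintro ⟨i, j, hi, hij, hj, heq, hmax⟩
  set d := bdelta (a i) (a (i + 1))
  have hle : ∀ k, i + 1 ≤ k → k ≤ j → a (i + 1) ≤ a k := by
    intro k hk
    induction k, hk using Nat.le_induction with
    | base => exact fun _ => le_rfl
    | succ k hk ih => exact fun hkj => (ih (by omega)).trans (ha k (by omega) (by omega)).le
  have hhigh : ∀ k, i ≤ k → k ≤ j + 1 → a i / 2 ^ (d + 1) = a k / 2 ^ (d + 1) := by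
    intro k hk
    induction k, hk using Nat.le_induction with
    | base => exact fun _ => rfl
    | succ k hk ih =>
      exact fun hkj => (ih (by omega)).trans
        (div_two_pow_eq_of_bdelta_lt (Nat.lt_succ_of_le (hmax k (by omega) (by omega))))
  have hlt_i : a i / 2 ^ d < a (i + 1) / 2 ^ d :=
    div_two_pow_bdelta_lt (ha i hi (by omega))
  have hlt_j : a j / 2 ^ d < a (j + 1) / 2 ^ d := by
    rw [heq]
    exact div_two_pow_bdelta_lt (ha j (by omega) (by omega))
  have hmid : a (i + 1) / 2 ^ d ≤ a j / 2 ^ d := Nat.div_le_div_right (hle j hij le_rfl)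
  have hquot := hhigh (j + 1) (by omega) le_rfl
  rw [pow_succ, ← Nat.div_div_eq_div_mul, ← Nat.div_div_eq_div_mul] at hquot
  omega
end

section
/- Let a_1 < a_2 < ... < a_r be nonnegative integers and let 1 ≤ p < q ≤ r−1 be indices such that δ_i ≤ δ_p for all p ≤ i ≤ q−1. Then δ_p ≠ δ_q. (In particular, any two consecutive local maxima of the sequence δ_1, ..., δ_{r−1} are distinct.) -/
theorem finite_setOf_testBit_ne (a b : ℕ) : {i | a.testBit i ≠ b.testBit i}.Finite := by
  refine (Set.finite_lt_nat (a + b)).subset fun i hi => ?_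
  by_contra hlt
  have hle : a + b ≤ i := not_lt.mp hlt
  have hi2 : i < 2 ^ i := Nat.lt_two_pow_self
  exact hi (by rw [Nat.testBit_eq_false_of_lt (by omega : a < 2 ^ i),
    Nat.testBit_eq_false_of_lt (by omega : b < 2 ^ i)])

theorem testBit_eq_of_bdelta_lt {a b j : ℕ} (h : bdelta a b < j) :
    a.testBit j = b.testBit j := by
  by_contra hne
  exact absurd (le_csSup (finite_setOf_testBit_ne a b).bddAbove hne) (not_le.mpr h)

theorem testBit_bdelta_of_lt {a b : ℕ} (h : a < b) :
    a.testBit (bdelta a b) = false ∧ b.testBit (bdelta a b) = true := by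
  have hne := testBit_bdelta_ne h.ne
  cases hA : a.testBit (bdelta a b) <;> cases hB : b.testBit (bdelta a b)
  · simp [hA, hB] at hne
  · simp
  · exact absurd (Nat.lt_of_testBit _ hB hA fun j hj => (testBit_eq_of_bdelta_lt hj).symm)
      h.not_gt
  · simp [hA, hB] at hne

/-- Let `a 1 < a 2 < ⋯ < a r` be nonnegative integers and let `1 ≤ p < q ≤ r-1` be indices
such that `δ_i ≤ δ_p` for all `p ≤ i ≤ q-1` (where `δ_i = δ(a_i, a_{i+1})`).
Then `δ_p ≠ δ_q`. -/
theorem stmt8 (r : ℕ) (a : ℕ → ℕ)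
    (ha : ∀ i, 1 ≤ i → i < r → a i < a (i + 1))
    (p q : ℕ) (hp : 1 ≤ p) (hpq : p < q) (hq : q ≤ r - 1)
    (hmax : ∀ i, p ≤ i → i ≤ q - 1 →
      bdelta (a i) (a (i + 1)) ≤ bdelta (a p) (a (p + 1))) :
    bdelta (a p) (a (p + 1)) ≠ bdelta (a q) (a (q + 1)) := by
  intro heq
  have key : ∀ m, p + 1 ≤ m → m ≤ q → a (p + 1) ≤ a m ∧
      ∀ j, bdelta (a p) (a (p + 1)) < j → (a m).testBit j = (a (p + 1)).testBit j := by
    intro m hm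
    induction m, hm using Nat.le_induction with
    | base => exact fun _ => ⟨le_rfl, fun _ _ => rfl⟩
    | succ m hm ih =>
      intro hmq
      obtain ⟨hle, hbits⟩ := ih (by omega)
      refine ⟨hle.trans (ha m (by omega) (by omega)).le, fun j hj => ?_⟩
      rw [← hbits j hj]
      exact (testBit_eq_of_bdelta_lt ((hmax m (by omega) (by omega)).trans_lt hj)).symm
  obtain ⟨hle, hbits⟩ := key q hpq le_rfl
  have hone := (testBit_bdelta_of_lt (ha p hp (by omega))).2
  have hzero := (testBit_bdelta_of_lt (ha q (by omega) (by omega))).1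
  rw [← heq] at hzero
  exact absurd (Nat.lt_of_testBit _ hzero hone hbits) hle.not_gt
end

section
/- Let n, N ≥ 1 and let φ be a red/blue coloring of the 3-element subsets of {0, 1, ..., N−1} having no n vertices all of whose triples are blue. Define a red/blue coloring χ of the 4-element subsets of {0, 1, ..., 2^N − 1} by: for a_1 < a_2 < a_3 < a_4, set χ(a_1,a_2,a_3,a_4) = φ(δ_1, δ_2, δ_3) if δ_1, δ_2, δ_3 form a strictly monotone sequence, and χ(a_1,a_2,a_3,a_4) = blue otherwise. Then there do not exist 2^{2n} vertices of {0, 1, ..., 2^N − 1} all of whose 4-subsets are blue under χ. -/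
theorem bdelta_comm (a b : ℕ) : bdelta a b = bdelta b a := by
  simp only [bdelta, ne_comm]

theorem bdelta_eq_of_testBit {a b k : ℕ} (hk : a.testBit k ≠ b.testBit k)
    (h : ∀ i, k < i → a.testBit i = b.testBit i) : bdelta a b = k := by
  refine IsGreatest.csSup_eq ⟨hk, fun i hi => ?_⟩
  by_contra hlt
  exact hi (h i (not_le.mp hlt))

/-- `DeltaChain r S T` says that `T` consists of the values `bdelta` takes on a sequence of
elements of `S` which is monotone in the direction of `r` and along which `bdelta` grows: the
sequence starts at `e`, and `f t` is the point at which the value `t` is attained. -/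
def DeltaChain (r : ℕ → ℕ → Prop) (S T : Finset ℕ) : Prop :=
  ∃ e ∈ S, ∃ f : ℕ → ℕ, ∀ t ∈ T, f t ∈ S ∧ r (f t) e ∧ bdelta (f t) e = t ∧
    ∀ s ∈ T, s < t → r (f t) (f s) ∧ bdelta (f t) (f s) = t

namespace DeltaChain

variable {r : ℕ → ℕ → Prop} {S S' T : Finset ℕ}

theorem empty (hS : S.Nonempty) : DeltaChain r S ∅ := by
  obtain ⟨e, he⟩ := hS
  exact ⟨e, he, id, by simp⟩

theorem mono (h : DeltaChain r S T) (hS : S ⊆ S') : DeltaChain r S' T := by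
  obtain ⟨e, he, f, hf⟩ := h
  exact ⟨e, hS he, f, fun t ht => ⟨hS (hf t ht).1, (hf t ht).2⟩⟩

theorem insert {k v : ℕ} (h : DeltaChain r S T) (hS : S ⊆ S') (hT : T ⊆ Finset.range k)
    (hv : v ∈ S') (hr : ∀ x ∈ S, r v x ∧ bdelta v x = k) :
    DeltaChain r S' (insert k T) := by
  obtain ⟨e, he, f, hf⟩ := h
  have hlt : ∀ t ∈ T, t < k := fun t ht => Finset.mem_range.mp (hT ht)
  refine ⟨e, hS he, Function.update f k v, fun t ht => ?_⟩
  rcases Finset.mem_insert.mp ht with rfl | ht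
  · rw [Function.update_self]
    refine ⟨hv, (hr e he).1, (hr e he).2, fun s hs hst => ?_⟩
    rw [Function.update_of_ne hst.ne]
    exact hr _ (hf s (Finset.mem_of_mem_insert_of_ne hs hst.ne)).1
  · rw [Function.update_of_ne (hlt t ht).ne]
    obtain ⟨h1, h2, h3, h4⟩ := hf t ht
    refine ⟨hS h1, h2, h3, fun s hs hst => ?_⟩
    have hsk : s ≠ k := (hst.trans (hlt t ht)).ne
    rw [Function.update_of_ne hsk]
    exact h4 s (Finset.mem_of_mem_insert_of_ne hs hsk) hst

end DeltaChain

/-- A set of `2 ^ (p + q)` numbers which agree on all binary digits from `N` on carries a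
decreasing chain with `p` values of `bdelta` or an increasing one with `q` values. -/
theorem exists_deltaChain (N : ℕ) : ∀ (p q : ℕ) (S : Finset ℕ),
    (∀ x ∈ S, ∀ y ∈ S, ∀ i, N ≤ i → x.testBit i = y.testBit i) → 2 ^ (p + q) ≤ S.card →
    ∃ T ⊆ Finset.range N,
      (T.card = p ∧ DeltaChain (· < ·) S T) ∨ (T.card = q ∧ DeltaChain (· > ·) S T) := by
  induction N with
  | zero =>
    intro p q S hS hc
    have h1 : S.card ≤ 1 := Finset.card_le_one.mpr fun x hx y hy =>
      Nat.eq_of_testBit_eq fun i => hS x hx y hy i (Nat.zero_le i)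
    have hpq : p + q = 0 := by
      by_contra h
      exact absurd (Nat.one_lt_two_pow h) (by omega)
    have hne : S.Nonempty := Finset.card_pos.mp ((Nat.two_pow_pos _).trans_le hc)
    exact ⟨∅, by simp, Or.inl ⟨by simp; omega, .empty hne⟩⟩
  | succ N ih =>
    intro p q S hS hc
    have hne : S.Nonempty := Finset.card_pos.mp ((Nat.two_pow_pos _).trans_le hc)
    rcases p with _ | p
    · exact ⟨∅, by simp, Or.inl ⟨by simp, .empty hne⟩⟩
    rcases q with _ | q
    · exact ⟨∅, by simp, Or.inr ⟨by simp, .empty hne⟩⟩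
    have hrange : Finset.range N ⊆ Finset.range (N + 1) :=
      Finset.range_subset_range.mpr N.le_succ
    have hinsert {T : Finset ℕ} (hT : T ⊆ Finset.range N) :
        insert N T ⊆ Finset.range (N + 1) ∧ (insert N T).card = T.card + 1 := by
      refine ⟨Finset.insert_subset (by simp) (hT.trans hrange), Finset.card_insert_of_notMem ?_⟩
      exact fun h => by simpa using hT h
    have agree {b : Bool} : ∀ x ∈ S.filter (·.testBit N = b), ∀ y ∈ S.filter (·.testBit N = b),
        ∀ i, N ≤ i → x.testBit i = y.testBit i := by
      intro x hx y hy i hi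
      rw [Finset.mem_filter] at hx hy
      rcases hi.eq_or_lt with rfl | hi
      · rw [hx.2, hy.2]
      · exact hS x hx.1 y hy.1 i hi
    have cross {x y : ℕ} (hx : x ∈ S.filter (·.testBit N = false))
        (hy : y ∈ S.filter (·.testBit N = true)) : x < y ∧ bdelta x y = N := by
      rw [Finset.mem_filter] at hx hy
      have h := fun i (hi : N < i) => hS x hx.1 y hy.1 i hi
      exact ⟨Nat.lt_of_testBit N hx.2 hy.2 h, bdelta_eq_of_testBit (by simp [hx.2, hy.2]) h⟩
    have hsum : (S.filter (·.testBit N = true)).card +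
        (S.filter (·.testBit N = false)).card = S.card := by
      simpa using Finset.card_filter_add_card_filter_not (s := S) (·.testBit N = true)
    have hsub (b : Bool) : S.filter (·.testBit N = b) ⊆ S := Finset.filter_subset _ _
    have hpow : 2 ^ (p + 1 + (q + 1)) = 2 ^ (p + 1 + q) + 2 ^ (p + 1 + q) := by ring
    have hpow' : 2 ^ (p + (q + 1)) = 2 ^ (p + 1 + q) := by ring
    rcases (S.filter (·.testBit N = false)).eq_empty_or_nonempty with h0 | ⟨v, hv⟩
    · obtain ⟨T, hT, h⟩ := ih (p + 1) (q + 1) _ (agree (b := true))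
        (by rw [h0, Finset.card_empty] at hsum; omega)
      exact ⟨T, hT.trans hrange, h.imp (And.imp_right (·.mono (hsub _)))
        (And.imp_right (·.mono (hsub _)))⟩
    rcases (S.filter (·.testBit N = true)).eq_empty_or_nonempty with h1 | ⟨w, hw⟩
    · obtain ⟨T, hT, h⟩ := ih (p + 1) (q + 1) _ (agree (b := false))
        (by rw [h1, Finset.card_empty] at hsum; omega)
      exact ⟨T, hT.trans hrange, h.imp (And.imp_right (·.mono (hsub _)))
        (And.imp_right (·.mono (hsub _)))⟩
    rcases le_total (2 ^ (p + 1 + q)) (S.filter (·.testBit N = true)).card with hbig | hsmall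
    · obtain ⟨T, hT, ⟨hTc, h⟩ | ⟨hTc, h⟩⟩ := ih p (q + 1) _ agree (hpow'.trans_le hbig)
      · refine ⟨insert N T, (hinsert hT).1, Or.inl ⟨by rw [(hinsert hT).2, hTc], ?_⟩⟩
        exact h.insert (hsub _) hT (hsub _ hv) fun x hx => cross hv hx
      · exact ⟨T, hT.trans hrange, Or.inr ⟨hTc, h.mono (hsub _)⟩⟩
    · obtain ⟨T, hT, ⟨hTc, h⟩ | ⟨hTc, h⟩⟩ := ih (p + 1) q _ (agree (b := false)) (by omega)
      · exact ⟨T, hT.trans hrange, Or.inl ⟨hTc, h.mono (hsub _)⟩⟩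
      · refine ⟨insert N T, (hinsert hT).1, Or.inr ⟨by rw [(hinsert hT).2, hTc], ?_⟩⟩
        refine h.insert (hsub _) hT (hsub _ hw) fun x hx => ?_
        exact ⟨(cross hx hw).1, (bdelta_comm w x).trans (cross hx hw).2⟩

theorem Finset.exists_lt_lt_of_card_eq_three {α : Type*} [LinearOrder α] {e : Finset α}
    (he : e.card = 3) : ∃ x y z, x < y ∧ y < z ∧ e = {x, y, z} := by
  let g := e.orderEmbOfFin he
  refine ⟨g 0, g 1, g 2, g.strictMono (by decide), g.strictMono (by decide), ?_⟩
  rw [← Finset.coe_inj, ← Finset.range_orderEmbOfFin e he]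
  ext x
  rw [Set.mem_range, Fin.exists_fin_succ, Fin.exists_fin_two]
  simp [g, eq_comm]

theorem mem_powersetCard_four {S : Finset ℕ} {a b c d : ℕ} (ha : a ∈ S) (hb : b ∈ S)
    (hc : c ∈ S) (hd : d ∈ S) (hab : a < b) (hbc : b < c) (hcd : c < d) :
    ({a, b, c, d} : Finset ℕ) ∈ S.powersetCard 4 := by
  refine Finset.mem_powersetCard.mpr ⟨by simp [Finset.insert_subset_iff, *], ?_⟩
  have h1 := (hab.trans hbc).ne
  have h2 := (hab.trans (hbc.trans hcd)).ne
  have h3 := (hbc.trans hcd).ne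
  simp [hab.ne, hbc.ne, hcd.ne, h1, h2, h3]

/-- Let `n, N ≥ 1` and let `φ` be a red/blue coloring (`red = true`) of the 3-element subsets of
`{0,…,N-1}` having no `n` vertices all of whose triples are blue. Define a coloring `χ` of the
4-element subsets of `{0,…,2^N - 1}` by: for `a₁ < a₂ < a₃ < a₄`,
`χ {a₁,a₂,a₃,a₄} = φ {δ₁,δ₂,δ₃}` if `δ₁, δ₂, δ₃` form a strictly monotone sequence, and
`χ {a₁,a₂,a₃,a₄} = blue` (`false`) otherwise. Then there do not exist `2^(2n)` vertices of
`{0,…,2^N - 1}` all of whose 4-subsets are blue under `χ`. -/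
theorem stmt13 (n N : ℕ) (hn : 1 ≤ n) (hN : 1 ≤ N) (φ : Finset ℕ → Bool)
    (hφ : ¬ ∃ T ⊆ Finset.range N, T.card = n ∧ ∀ e ∈ T.powersetCard 3, φ e = false)
    (χ : Finset ℕ → Bool)
    (hχ : ∀ a1 a2 a3 a4 : ℕ, a1 < a2 → a2 < a3 → a3 < a4 → a4 < 2 ^ N →
      χ {a1, a2, a3, a4} =
        if (bdelta a1 a2 < bdelta a2 a3 ∧ bdelta a2 a3 < bdelta a3 a4) ∨
            (bdelta a3 a4 < bdelta a2 a3 ∧ bdelta a2 a3 < bdelta a1 a2)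
          then φ {bdelta a1 a2, bdelta a2 a3, bdelta a3 a4}
          else false) :
    ¬ ∃ S ⊆ Finset.range (2 ^ N), S.card = 2 ^ (2 * n) ∧
      ∀ e ∈ S.powersetCard 4, χ e = false := by
  rintro ⟨S, hSN, hSc, hblue⟩
  have hlt : ∀ x ∈ S, x < 2 ^ N := fun x hx => Finset.mem_range.mp (hSN hx)
  obtain ⟨T, hTN, hT⟩ := exists_deltaChain N n n S
    (fun x hx y hy i hi => by
      have hpow := Nat.pow_le_pow_right two_pos hi
      rw [Nat.testBit_lt_two_pow ((hlt x hx).trans_le hpow),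
        Nat.testBit_lt_two_pow ((hlt y hy).trans_le hpow)])
    (by rw [hSc, two_mul])
  refine hφ ⟨T, hTN, hT.elim And.left And.left, fun e he => ?_⟩
  obtain ⟨heT, he3⟩ := Finset.mem_powersetCard.mp he
  obtain ⟨x, y, z, hxy, hyz, rfl⟩ := Finset.exists_lt_lt_of_card_eq_three he3
  have hx : x ∈ T := heT (by simp)
  have hy : y ∈ T := heT (by simp)
  have hz : z ∈ T := heT (by simp)
  rcases hT with ⟨-, e, he, f, hf⟩ | ⟨-, e, he, f, hf⟩
  · obtain ⟨hfx, hxe, hdx, -⟩ := hf x hx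
    obtain ⟨hfy, -, -, hfy'⟩ := hf y hy
    obtain ⟨hfz, -, -, hfz'⟩ := hf z hz
    obtain ⟨hyx, hdy⟩ := hfy' x hx hxy
    obtain ⟨hzy, hdz⟩ := hfz' y hy hyz
    have h := hχ _ _ _ _ hzy hyx hxe (hlt e he)
    rw [hblue _ (mem_powersetCard_four hfz hfy hfx he hzy hyx hxe), hdx, hdy, hdz,
      if_pos (Or.inr ⟨hxy, hyz⟩)] at h
    have hrev : ({x, y, z} : Finset ℕ) = {z, y, x} := by
      ext
      simp only [Finset.mem_insert, Finset.mem_singleton]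
      tauto
    rw [hrev, h]
  · obtain ⟨hfx, hxe, hdx, -⟩ := hf x hx
    obtain ⟨hfy, -, -, hfy'⟩ := hf y hy
    obtain ⟨hfz, -, -, hfz'⟩ := hf z hz
    obtain ⟨hyx, hdy⟩ := hfy' x hx hxy
    obtain ⟨hzy, hdz⟩ := hfz' y hy hyz
    have h := hχ _ _ _ _ hxe hyx hzy (hlt _ hfz)
    rw [hblue _ (mem_powersetCard_four he hfx hfy hfz hxe hyx hzy), bdelta_comm e (f x),
      bdelta_comm (f x) (f y), bdelta_comm (f y) (f z), hdx, hdy, hdz,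
      if_pos (Or.inl ⟨hxy, hyz⟩)] at h
    exact h.symm
end
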